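/- arXiv:2109.11465 — 4 statements merged into one kernel-verified Lean document; each statement's English description precedes it below -/
import Mathlib

section
/- Let q ≥ 2 with conjugate exponent q' = q/(q−1), let Φ̃ be a Young function and set Φ(t) = Φ̃(t^{q'}), and let μ be a positive Borel measure on ℂ₊. Then there is a constant C depending only on q such that ‖𝓛 : L^Φ(0,∞) → L^q(ℂ₊, μ)‖^q ≤ C·∑_{n∈ℤ} (2^n·‖t ↦ e^{−q'·2^{n−1}·t}‖_{L^{Φ̃^c}(0,∞)})^{q−1}·𝒞_q[μ_n], where Φ̃^c is the complementary Young function of Φ̃. -/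
open MeasureTheory Set Complex Filter
open scoped ENNReal NNReal

noncomputable section

/-- The Laplace transform of `f : (0,∞) → ℂ`. -/
def laplace (f : ℝ → ℂ) (z : ℂ) : ℂ :=
  ∫ t in Ioi (0:ℝ), Complex.exp (-z * t) * f t

/-- The Laplace transform of `f : (0,τ) → ℂ`. -/
def laplaceOn (τ : ℝ) (f : ℝ → ℂ) (z : ℂ) : ℂ :=
  ∫ t in Ioo (0:ℝ) τ, Complex.exp (-z * t) * f t

/-- The Carleson square `Q_I` over the interval `I = i[a,b]` on the imaginary axis. -/
def carlesonSquare (a b : ℝ) : Set ℂ :=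
  {z : ℂ | z.im ∈ Icc a b ∧ z.re ∈ Ioo 0 (b - a)}

/-- The `α`-Carleson intensity of a measure on the right half-plane. -/
def carlesonIntensity (α : ℝ) (ν : Measure ℂ) : ℝ≥0∞ :=
  ⨆ (a : ℝ) (b : ℝ) (_ : a < b),
    ν (carlesonSquare a b) / ENNReal.ofReal ((b - a) ^ α)

/-- The dyadic strip `S_n = {2^n ≤ Re z < 2^(n+1)}`. -/
def dyadicStrip (n : ℤ) : Set ℂ :=
  {z : ℂ | (2:ℝ) ^ n ≤ z.re ∧ z.re < (2:ℝ) ^ (n + 1)}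

/-- `μ_n`, the restriction of `μ` to the dyadic strip `S_n`. -/
def stripPart (μ : Measure ℂ) (n : ℤ) : Measure ℂ := μ.restrict (dyadicStrip n)

/-- A Young function: increasing, continuous, convex on `[0,∞)`, with
`Φ(t)/t → 0` as `t → 0⁺` and `Φ(t)/t → ∞` as `t → ∞`. -/
def YoungFunction (Φ : ℝ → ℝ) : Prop :=
  (∀ t, 0 ≤ t → 0 ≤ Φ t) ∧ MonotoneOn Φ (Ici 0) ∧ ContinuousOn Φ (Ici 0) ∧
    ConvexOn ℝ (Ici 0) Φ ∧
    Tendsto (fun t => Φ t / t) (nhdsWithin 0 (Ioi 0)) (nhds 0) ∧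
    Tendsto (fun t => Φ t / t) atTop atTop

/-- The Luxemburg (Orlicz) norm of `f` on `J` w.r.t. the Young function `Φ`. -/
def luxNorm (Φ : ℝ → ℝ) (J : Set ℝ) (f : ℝ → ℂ) : ℝ≥0∞ :=
  ⨅ (k : ℝ) (_ : 0 < k)
    (_ : (∫⁻ s in J, ENNReal.ofReal (Φ (‖f s‖ / k))) ≤ 1), ENNReal.ofReal k

/-- The complementary Young function `Φᶜ(s) = sup_{t ≥ 0} (st - Φ(t))`. -/
def youngConj (Φ : ℝ → ℝ) (s : ℝ) : ℝ :=
  sSup {u : ℝ | ∃ t : ℝ, 0 ≤ t ∧ u = s * t - Φ t}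

/-- The operator norm of the Laplace–Carleson embedding `𝓛 : L^Φ(0,∞) → L^q(ℂ₊,μ)`. -/
def lapOrliczOpNorm (Φ : ℝ → ℝ) (μ : Measure ℂ) (q : ℝ) : ℝ≥0∞ :=
  ⨆ (f : ℝ → ℂ) (_ : Measurable f) (_ : luxNorm Φ (Ioi 0) f ≤ 1),
    eLpNorm (laplace f) (ENNReal.ofReal q) μ

theorem integrableOn_mul_exp_neg {c : ℝ} (hc : 0 < c) :
    IntegrableOn (fun t : ℝ => t * Real.exp (-c * t)) (Ioi 0) := by
  have := integrableOn_rpow_mul_exp_neg_mul_rpow (p := 1) (s := 1) (b := c)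
    (by norm_num) one_pos hc
  simpa using this

theorem integral_mul_exp_neg {s : ℂ} (hs : 0 < s.re) :
    ∫ t in Ioi (0:ℝ), (t:ℂ) * Complex.exp (-s * t) = 1 / s ^ 2 := by
  have hs0 : s ≠ 0 := fun h => by simp [h] at hs
  have hnorm : ∀ t : ℝ, ‖Complex.exp (-s * t)‖ = Real.exp (-s.re * t) := fun t => by
    simp [Complex.norm_exp]
  have key := integral_Ioi_of_hasDerivAt_of_tendsto (a := 0) (m := 0)
    (f := fun t : ℝ => -((t:ℂ) / s + 1 / s ^ 2) * Complex.exp (-s * t))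
    (f' := fun t : ℝ => (t:ℂ) * Complex.exp (-s * t)) ?_ ?_ ?_ ?_
  · rw [key]; simp
  · fun_prop
  · intro t _
    have h1 : HasDerivAt (fun t : ℝ => (t:ℂ)) 1 t := Complex.ofRealCLM.hasDerivAt
    have h2 := (((h1.div_const s).add_const (1 / s ^ 2)).neg).mul (h1.const_mul (-s)).cexp
    refine h2.congr_deriv ?_
    simp only [Pi.neg_apply]
    field_simp
    ring
  · refine (integrableOn_mul_exp_neg hs).mono' (by fun_prop) ?_
    filter_upwards [ae_restrict_mem measurableSet_Ioi] with t ht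
    rw [norm_mul, hnorm, Complex.norm_real, Real.norm_of_nonneg (le_of_lt ht)]
  · rw [tendsto_zero_iff_norm_tendsto_zero]
    have h1 := Real.tendsto_pow_mul_exp_neg_atTop_nhds_zero 1
    have h0 := Real.tendsto_pow_mul_exp_neg_atTop_nhds_zero 0
    have hl : Tendsto (fun t : ℝ => s.re * t) atTop atTop := tendsto_id.const_mul_atTop hs
    have h1' := (h1.comp hl).const_mul (1 / (s.re * ‖s‖))
    have h0' := (h0.comp hl).const_mul (1 / ‖s‖ ^ 2)
    have := h1'.add h0'
    simp only [mul_zero, add_zero] at this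
    refine squeeze_zero' (Eventually.of_forall fun t => norm_nonneg _) ?_ this
    filter_upwards [eventually_ge_atTop 0] with t ht
    rw [norm_mul, hnorm, norm_neg]
    have : ‖(t:ℂ) / s + 1 / s ^ 2‖ ≤ t / ‖s‖ + 1 / ‖s‖ ^ 2 := by
      refine (norm_add_le _ _).trans ?_
      simp [abs_of_nonneg ht]
    refine (mul_le_mul_of_nonneg_right this (Real.exp_nonneg _)).trans (le_of_eq ?_)
    simp only [Function.comp, neg_mul]
    have : ‖s‖ ≠ 0 := by simpa using hs0
    field_simp

theorem norm_exp_div_sq_le {b : ℝ} (hb : 0 < b) {s : ℂ} (h1 : 2 * b ≤ s.re)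
    (h2 : s.re ≤ 6 * b) :
    ‖b * Complex.exp (s / b) / s ^ 2‖ ≤ b * Real.exp 6 * (1 / (4 * b ^ 2 + s.im ^ 2)) := by
  have hn : ‖s‖ ^ 2 = s.re ^ 2 + s.im ^ 2 := by
    rw [← Complex.normSq_eq_norm_sq, Complex.normSq_apply]; ring
  rw [norm_div, norm_mul, norm_pow, hn, Complex.norm_real, Real.norm_of_nonneg hb.le,
    Complex.norm_exp, Complex.div_ofReal_re, div_eq_mul_one_div]
  gcongr
  · rw [div_le_iff₀ hb]; exact h2
  · nlinarith

/-- The constant `∑_{k ∈ ℤ} 1 / (1 + k²)`. -/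
def latticeConst : ℝ := ∑' k : ℤ, 1 / (1 + (k:ℝ) ^ 2)

theorem summable_latticeConst : Summable fun k : ℤ => 1 / (1 + (k:ℝ) ^ 2) := by
  have h : Summable fun k : ℤ => 1 / (k:ℝ) ^ 2 := Real.summable_one_div_int_pow.2 one_lt_two
  refine Summable.of_norm_bounded_eventually h ?_
  filter_upwards [(Set.finite_singleton (0:ℤ)).compl_mem_cofinite] with k hk
  have hk : (k:ℝ) ≠ 0 := by simpa using hk
  rw [Real.norm_of_nonneg (by positivity)]
  have : 0 < (k:ℝ) ^ 2 := by positivity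
  gcongr
  linarith

theorem latticeConst_pos : 0 < latticeConst :=
  summable_latticeConst.tsum_pos (fun k => by positivity) 0 (by norm_num)

theorem lintegral_poisson_le {b : ℝ} (hb : 0 < b) {ν : Measure ℂ} {M : ℝ≥0∞}
    (hM : ∀ y : ℝ, ν {w : ℂ | y ≤ w.im ∧ w.im ≤ y + 4 * b} ≤ M) (y : ℝ) :
    ∫⁻ w, ENNReal.ofReal (1 / (4 * b ^ 2 + (w.im - y) ^ 2)) ∂ν ≤
      ENNReal.ofReal (3 / (4 * b ^ 2) * latticeConst) * M := by
  set c : ℤ → ℝ≥0∞ := fun k => ENNReal.ofReal (3 / (4 * b ^ 2) * (1 / (1 + (k:ℝ) ^ 2))) with hc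
  set S : ℤ → Set ℂ := fun k =>
    {w : ℂ | y + 4 * b * k ≤ w.im ∧ w.im ≤ y + 4 * b * k + 4 * b} with hS
  have hSm : ∀ k, MeasurableSet (S k) := fun k =>
    (measurableSet_le measurable_const Complex.measurable_im).inter
      (measurableSet_le Complex.measurable_im measurable_const)
  calc ∫⁻ w, ENNReal.ofReal (1 / (4 * b ^ 2 + (w.im - y) ^ 2)) ∂ν
      ≤ ∫⁻ w, ∑' k, (S k).indicator (fun _ => c k) w ∂ν := by
        refine lintegral_mono fun w => ?_
        set k := ⌊(w.im - y) / (4 * b)⌋ with hk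
        have h1 := Int.floor_le ((w.im - y) / (4 * b))
        have h2 := (Int.lt_floor_add_one ((w.im - y) / (4 * b))).le
        rw [← hk] at h1 h2
        rw [le_div_iff₀ (by positivity)] at h1
        rw [div_le_iff₀ (by positivity)] at h2
        have hw : w ∈ S k := ⟨by linarith, by linarith⟩
        refine le_trans ?_ (ENNReal.le_tsum k)
        rw [Set.indicator_of_mem hw, hc]
        refine ENNReal.ofReal_le_ofReal ?_
        obtain ⟨θ, hθ⟩ : ∃ θ, w.im - y = 4 * b * (k + θ) :=
          ⟨(w.im - y) / (4 * b) - k, by field_simp; ring⟩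
        rw [hθ] at h1 h2 ⊢
        have hθ0 : 0 ≤ θ := by
          by_contra! h; nlinarith
        have hθ1 : θ ≤ 1 := by
          by_contra! h; nlinarith
        rw [div_mul_div_comm, mul_one, div_le_div_iff₀ (by positivity) (by positivity)]
        have : 1 + (k:ℝ) ^ 2 ≤ 3 * (1 + 4 * (k + θ) ^ 2) := by
          nlinarith [sq_nonneg ((k:ℝ) + 2 * θ), sq_nonneg ((k:ℝ) + θ)]
        nlinarith [mul_le_mul_of_nonneg_left this (by positivity : 0 ≤ 4 * b ^ 2)]
    _ = ∑' k, c k * ν (S k) := by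
        rw [lintegral_tsum fun k => (measurable_const.indicator (hSm k)).aemeasurable]
        exact tsum_congr fun k => lintegral_indicator_const (hSm k) _
    _ ≤ ∑' k, c k * M := ENNReal.tsum_le_tsum fun k => by gcongr; exact hM _
    _ = _ := by
        rw [ENNReal.tsum_mul_right, hc, latticeConst, ← tsum_mul_left,
          ENNReal.ofReal_tsum_of_nonneg (fun k => by positivity)
            (summable_latticeConst.mul_left _)]

theorem enorm_integral_ofReal_of_nonneg {α : Type*} [MeasurableSpace α] {ν : Measure α}
    {r : α → ℝ} (hr : ∀ x, 0 ≤ r x) (hi : Integrable r ν) :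
    ‖∫ x, (r x : ℂ) ∂ν‖ₑ = ∫⁻ x, ENNReal.ofReal (r x) ∂ν := by
  rw [integral_complex_ofReal, ← ofReal_integral_eq_lintegral_ofReal hi (Eventually.of_forall hr),
    ← ofReal_norm, Complex.norm_real, Real.norm_of_nonneg (integral_nonneg hr)]

theorem ENNReal.mul_le_sq_add_sq (a b : ℝ≥0∞) : a * b ≤ a ^ 2 + b ^ 2 := by
  rcases le_total a b with h | h
  · exact (by gcongr : a * b ≤ b * b).trans (by rw [← sq]; exact le_add_self)
  · exact (by gcongr : a * b ≤ a * a).trans (by rw [← sq]; exact le_self_add)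

/-- The constant in the `L²` Carleson embedding for the strip `b ≤ Re z ≤ 3b`. -/
def stripConst (b : ℝ) : ℝ :=
  2 * (b * Real.exp 6 * (3 / (4 * b ^ 2) * latticeConst))

/-- The formal adjoint of the Laplace transform is bounded on `L²`. -/
theorem lintegral_adjoint_laplace_sq_le {b : ℝ} (hb : 0 < b) {ν : Measure ℂ} [IsFiniteMeasure ν]
    {M : ℝ≥0∞} (hM : ∀ y : ℝ, ν {w : ℂ | y ≤ w.im ∧ w.im ≤ y + 4 * b} ≤ M)
    (hre : ∀ᵐ z ∂ν, b ≤ z.re ∧ z.re ≤ 3 * b) {φ : ℂ → ℂ} (hφ : Measurable φ) {N : ℝ}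
    (hN : ∀ᵐ z ∂ν, ‖φ z‖ ≤ N) :
    ∫⁻ t in Ioi (0:ℝ), ‖∫ z, φ z * Complex.exp (-z * t) ∂ν‖ₑ ^ 2 ≤
      ENNReal.ofReal (stripConst b) * M * ∫⁻ z, ‖φ z‖ₑ ^ 2 ∂ν := by
  set G : ℝ → ℂ := fun t => ∫ z, φ z * Complex.exp (-z * t) ∂ν with hG
  set H : ℝ → ℂ × ℂ → ℂ := fun τ p => (b * τ : ℂ) *
    ((φ p.1 * Complex.exp (-p.1 * (τ - 1 / b : ℝ))) *
      (starRingEnd ℂ) (φ p.2 * Complex.exp (-p.2 * (τ - 1 / b : ℝ)))) with hH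
  have hre1 : ∀ᵐ p ∂(ν.prod ν), (b ≤ p.1.re ∧ p.1.re ≤ 3 * b) ∧ ‖φ p.1‖ ≤ N :=
    Measure.quasiMeasurePreserving_fst.ae (hre.and hN)
  have hre2 : ∀ᵐ p ∂(ν.prod ν), (b ≤ p.2.re ∧ p.2.re ≤ 3 * b) ∧ ‖φ p.2‖ ≤ N :=
    Measure.quasiMeasurePreserving_snd.ae (hre.and hN)
  have hHG : ∀ τ, ∫ p, H τ p ∂(ν.prod ν) = ((b * τ * ‖G (τ - 1 / b)‖ ^ 2 : ℝ) : ℂ) := by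
    intro τ
    simp only [hH]
    rw [integral_const_mul, integral_prod_mul (fun z => φ z * Complex.exp (-z * (τ - 1 / b : ℝ)))
      (fun z => (starRingEnd ℂ) (φ z * Complex.exp (-z * (τ - 1 / b : ℝ)))), integral_conj,
      Complex.mul_conj, Complex.normSq_eq_norm_sq]
    simp only [hG]
    push_cast
    rfl
  have hHi : Integrable (Function.uncurry H) ((volume.restrict (Ioi 0)).prod (ν.prod ν)) := by
    have hbase : Integrable (fun x : ℝ × (ℂ × ℂ) =>
        (x.1 * Real.exp (-(2 * b) * x.1)) * (b * N ^ 2 * Real.exp 6))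
        ((volume.restrict (Ioi 0)).prod (ν.prod ν)) :=
      Integrable.mul_prod (f := fun t : ℝ => t * Real.exp (-(2 * b) * t))
        (g := fun _ : ℂ × ℂ => b * N ^ 2 * Real.exp 6)
        (integrableOn_mul_exp_neg (by positivity)) (integrable_const _)
    refine hbase.mono' ?_ ?_
    · have : Measurable (Function.uncurry H) := by
        simp only [hH, Function.uncurry_def]
        have h1 : Measurable fun x : ℝ × ℂ × ℂ => φ x.2.1 := hφ.comp (by fun_prop)
        have h2 : Measurable fun x : ℝ × ℂ × ℂ => φ x.2.2 := hφ.comp (by fun_prop)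
        have h3 : Measurable fun x : ℝ × ℂ × ℂ => (starRingEnd ℂ)
            (φ x.2.2 * Complex.exp (-x.2.2 * (x.1 - 1 / b : ℝ))) :=
          Complex.continuous_conj.measurable.comp (h2.mul (by fun_prop))
        exact (by fun_prop : Measurable fun x : ℝ × ℂ × ℂ => (b * x.1 : ℂ)).mul
          ((h1.mul (by fun_prop)).mul h3)
      exact this.aestronglyMeasurable
    · have a1 : ∀ᵐ x ∂((volume.restrict (Ioi (0:ℝ))).prod (ν.prod ν)), 0 < x.1 :=
        Measure.quasiMeasurePreserving_fst.ae (ae_restrict_mem measurableSet_Ioi)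
      have a2 : ∀ᵐ x ∂((volume.restrict (Ioi (0:ℝ))).prod (ν.prod ν)), _ :=
        Measure.quasiMeasurePreserving_snd.ae (hre1.and hre2)
      filter_upwards [a1, a2] with x hx ⟨⟨h1, h1'⟩, ⟨h2, h2'⟩⟩
      obtain ⟨τ, z, w⟩ := x
      simp only [Function.uncurry_apply_pair, hH] at *
      have hN0 : 0 ≤ N := (norm_nonneg _).trans h1'
      rw [norm_mul, norm_mul, norm_mul, RCLike.norm_conj, norm_mul, norm_mul, Complex.norm_real,
        Complex.norm_real, Complex.norm_exp, Complex.norm_exp, Real.norm_of_nonneg hb.le,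
        Real.norm_of_nonneg hx.le]
      have e1 : ∀ u : ℂ, (-u * ((τ - 1 / b : ℝ) : ℂ)).re = -u.re * (τ - 1 / b) := by
        intro u; rw [Complex.re_mul_ofReal, Complex.neg_re]
      rw [e1, e1]
      have hexp : Real.exp (-z.re * (τ - 1 / b)) * Real.exp (-w.re * (τ - 1 / b)) ≤
          Real.exp (-(2 * b) * τ) * Real.exp 6 := by
        rw [← Real.exp_add, ← Real.exp_add]
        refine Real.exp_le_exp.2 ?_
        have k1 : (z.re + w.re) / b ≤ 6 := by rw [div_le_iff₀ hb]; linarith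
        have k2 : 2 * b * τ ≤ (z.re + w.re) * τ := by gcongr; linarith
        have k3 : -z.re * (τ - 1 / b) + -w.re * (τ - 1 / b) =
          (z.re + w.re) / b - (z.re + w.re) * τ := by ring
        linarith
      calc b * τ * (‖φ z‖ * Real.exp (-z.re * (τ - 1 / b)) *
              (‖φ w‖ * Real.exp (-w.re * (τ - 1 / b))))
          = b * τ * (‖φ z‖ * ‖φ w‖) *
            (Real.exp (-z.re * (τ - 1 / b)) * Real.exp (-w.re * (τ - 1 / b))) := by ring
        _ ≤ b * τ * (N * N) * (Real.exp (-(2 * b) * τ) * Real.exp 6) := by gcongr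
        _ = _ := by ring
  have hr : ∀ᵐ τ ∂(volume.restrict (Ioi (0:ℝ))), 0 ≤ b * τ * ‖G (τ - 1 / b)‖ ^ 2 := by
    filter_upwards [ae_restrict_mem measurableSet_Ioi] with τ hτ
    have : 0 < τ := hτ
    positivity
  have hri : Integrable (fun τ : ℝ => b * τ * ‖G (τ - 1 / b)‖ ^ 2)
      (volume.restrict (Ioi 0)) := by
    have := hHi.integral_prod_left
    simp only [Function.uncurry_apply_pair, hHG] at this
    exact this.re.congr (Eventually.of_forall fun τ => Complex.ofReal_re _)
  set κ : ℂ × ℂ → ℝ≥0∞ := fun p =>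
    ENNReal.ofReal (1 / (4 * b ^ 2 + (p.2.im - p.1.im) ^ 2)) with hκ
  have hκm : Measurable κ := by simp only [hκ]; fun_prop
  have hker : ∀ᵐ p ∂(ν.prod ν), ‖∫ τ in Ioi (0:ℝ), H τ p‖ₑ ≤
      ENNReal.ofReal (b * Real.exp 6) * (‖φ p.1‖ₑ * ‖φ p.2‖ₑ * κ p) := by
    filter_upwards [hre1, hre2] with p ⟨h1, _⟩ ⟨h2, _⟩
    set s : ℂ := p.1 + (starRingEnd ℂ) p.2 with hs
    have hsre : s.re = p.1.re + p.2.re := by simp [hs]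
    have hsim : s.im ^ 2 = (p.2.im - p.1.im) ^ 2 := by simp [hs]; ring
    have hb0 : (b:ℂ) ≠ 0 := by exact_mod_cast hb.ne'
    have : ∀ τ : ℝ, H τ p = (φ p.1 * (starRingEnd ℂ) (φ p.2) * (b * Complex.exp (s / b))) *
        ((τ:ℂ) * Complex.exp (-s * τ)) := by
      intro τ
      simp only [hH, map_mul, ← Complex.exp_conj, map_neg, Complex.conj_ofReal]
      have e : Complex.exp (-p.1 * (τ - 1 / b : ℝ)) *
          Complex.exp (-(starRingEnd ℂ) p.2 * (τ - 1 / b : ℝ)) =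
          Complex.exp (s / b) * Complex.exp (-s * τ) := by
        rw [← Complex.exp_add, ← Complex.exp_add]
        congr 1
        push_cast
        simp only [hs]
        field_simp
        ring
      linear_combination (b * τ * φ p.1 * (starRingEnd ℂ) (φ p.2)) * e
    simp only [this]
    rw [integral_const_mul, integral_mul_exp_neg (by rw [hsre]; linarith)]
    have k := norm_exp_div_sq_le hb (s := s) (by rw [hsre]; linarith) (by rw [hsre]; linarith)
    rw [hsim] at k
    have k' : ‖(b:ℂ) * Complex.exp (s / b) / s ^ 2‖ₑ ≤ ENNReal.ofReal (b * Real.exp 6) * κ p := by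
      rw [← ENNReal.ofReal_mul (by positivity), ← ofReal_norm]
      exact ENNReal.ofReal_le_ofReal k
    calc _ = ‖φ p.1‖ₑ * ‖φ p.2‖ₑ * ‖(b:ℂ) * Complex.exp (s / b) / s ^ 2‖ₑ := by
          rw [mul_assoc, mul_one_div, enorm_mul, enorm_mul, RCLike.enorm_conj]
      _ ≤ ‖φ p.1‖ₑ * ‖φ p.2‖ₑ * (ENNReal.ofReal (b * Real.exp 6) * κ p) := by gcongr
      _ = _ := by ring
  have hφ1 : Measurable fun p : ℂ × ℂ => ‖φ p.1‖ₑ ^ 2 * κ p :=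
    ((hφ.comp measurable_fst).enorm.pow_const 2).mul hκm
  have hφ2 : Measurable fun p : ℂ × ℂ => ‖φ p.2‖ₑ ^ 2 * κ p :=
    ((hφ.comp measurable_snd).enorm.pow_const 2).mul hκm
  set B := ENNReal.ofReal (3 / (4 * b ^ 2) * latticeConst) * M with hB
  have hI1 : ∫⁻ p, ‖φ p.1‖ₑ ^ 2 * κ p ∂(ν.prod ν) ≤ (∫⁻ z, ‖φ z‖ₑ ^ 2 ∂ν) * B := by
    rw [lintegral_prod _ hφ1.aemeasurable, ← lintegral_mul_const _ (hφ.enorm.pow_const 2)]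
    refine lintegral_mono fun z => ?_
    dsimp only
    rw [lintegral_const_mul _ (by simp only [hκ]; fun_prop)]
    gcongr
    exact lintegral_poisson_le hb hM z.im
  have hI2 : ∫⁻ p, ‖φ p.2‖ₑ ^ 2 * κ p ∂(ν.prod ν) ≤ (∫⁻ z, ‖φ z‖ₑ ^ 2 ∂ν) * B := by
    rw [lintegral_prod_symm _ hφ2.aemeasurable, ← lintegral_mul_const _ (hφ.enorm.pow_const 2)]
    refine lintegral_mono fun z => ?_
    dsimp only
    rw [lintegral_const_mul _ (by simp only [hκ]; fun_prop)]
    gcongr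
    refine (le_of_eq (lintegral_congr fun w => ?_)).trans (lintegral_poisson_le hb hM z.im)
    simp only [hκ]
    rw [← neg_sub, neg_sq]
  calc ∫⁻ t in Ioi (0:ℝ), ‖G t‖ₑ ^ 2
      ≤ ∫⁻ τ in Ioi (0:ℝ), ENNReal.ofReal (b * τ * ‖G (τ - 1 / b)‖ ^ 2) := by
        rw [← lintegral_indicator measurableSet_Ioi, ← lintegral_indicator measurableSet_Ioi,
          ← lintegral_sub_right_eq_self _ (1 / b)]
        refine lintegral_mono fun τ => ?_
        dsimp only
        by_cases hτ : 0 < τ - 1 / b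
        · have hτ' : 0 < τ := hτ.trans (sub_lt_self _ (by positivity))
          rw [indicator_of_mem (show τ - 1 / b ∈ Ioi (0:ℝ) from hτ),
            indicator_of_mem (show τ ∈ Ioi (0:ℝ) from hτ'), ← ofReal_norm,
            ← ENNReal.ofReal_pow (norm_nonneg _)]
          refine ENNReal.ofReal_le_ofReal (le_mul_of_one_le_left (by positivity) ?_)
          rw [sub_pos, div_lt_iff₀ hb] at hτ
          linarith
        · rw [indicator_of_notMem (show τ - 1 / b ∉ Ioi (0:ℝ) from hτ)]
          exact zero_le
    _ = ‖∫ τ in Ioi (0:ℝ), ∫ p, H τ p ∂(ν.prod ν)‖ₑ := by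
        simp only [hHG]
        rw [← ofReal_integral_eq_lintegral_ofReal hri hr, integral_complex_ofReal,
          ← ofReal_norm, Complex.norm_real,
          Real.norm_of_nonneg (integral_nonneg_of_ae hr)]
    _ = ‖∫ p, (∫ τ in Ioi (0:ℝ), H τ p) ∂(ν.prod ν)‖ₑ := by rw [integral_integral_swap hHi]
    _ ≤ ∫⁻ p, ‖∫ τ in Ioi (0:ℝ), H τ p‖ₑ ∂(ν.prod ν) := enorm_integral_le_lintegral_enorm _
    _ ≤ ∫⁻ p, ENNReal.ofReal (b * Real.exp 6) *
          (‖φ p.1‖ₑ ^ 2 * κ p + ‖φ p.2‖ₑ ^ 2 * κ p) ∂(ν.prod ν) := by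
        refine lintegral_mono_ae (hker.mono fun p hp => hp.trans ?_)
        rw [← add_mul]
        gcongr
        exact ENNReal.mul_le_sq_add_sq _ _
    _ ≤ ENNReal.ofReal (b * Real.exp 6) *
          ((∫⁻ z, ‖φ z‖ₑ ^ 2 ∂ν) * B + (∫⁻ z, ‖φ z‖ₑ ^ 2 ∂ν) * B) := by
        have e := lintegral_const_mul (μ := ν.prod ν) (ENNReal.ofReal (b * Real.exp 6))
          (hφ1.add hφ2)
        simp only [Pi.add_apply] at e
        rw [e, lintegral_add_left hφ1]
        gcongr
    _ = _ := by
        have hl := latticeConst_pos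
        rw [stripConst, ENNReal.ofReal_mul zero_le_two,
          ENNReal.ofReal_mul (p := b * Real.exp 6) (by positivity), hB,
          ENNReal.ofReal_ofNat]
        ring

theorem measurable_laplace {g : ℝ → ℂ} (hg : Measurable g) : Measurable (laplace g) := by
  have : StronglyMeasurable
      (Function.uncurry fun (z : ℂ) (t : ℝ) => Complex.exp (-z * t) * g t) := by
    have h : Measurable fun p : ℂ × ℝ => g p.2 := hg.comp measurable_snd
    exact ((by fun_prop : Measurable fun p : ℂ × ℝ =>
      Complex.exp (-p.1 * p.2)).mul h).stronglyMeasurable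
  exact this.integral_prod_right.measurable

theorem integrableOn_exp_neg_mul_norm {b : ℝ} (hb : 0 < b) {g : ℝ → ℂ} (hg : Measurable g)
    (hg2 : ∫⁻ t in Ioi (0:ℝ), ‖g t‖ₑ ^ 2 ≠ ∞) :
    IntegrableOn (fun t => Real.exp (-b * t) * ‖g t‖) (Ioi 0) := by
  have h1 : IntegrableOn (fun t : ℝ => Real.exp (-(2 * b) * t)) (Ioi 0) :=
    integrableOn_exp_mul_Ioi (by linarith) 0
  have h2 : IntegrableOn (fun t => ‖g t‖ ^ 2) (Ioi 0) := by
    refine ⟨(hg.norm.pow_const 2).aestronglyMeasurable, ?_⟩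
    rw [hasFiniteIntegral_iff_enorm]
    simpa [enorm_pow] using hg2.lt_top
  refine (h1.add h2).mono' (by fun_prop) (Eventually.of_forall fun t => ?_)
  have e : Real.exp (-(2 * b) * t) = Real.exp (-b * t) ^ 2 := by
    rw [← Real.exp_nat_mul]; congr 1; push_cast; ring
  rw [Real.norm_of_nonneg (by positivity), Pi.add_apply, e]
  nlinarith [sq_nonneg (Real.exp (-b * t) - ‖g t‖), sq_nonneg (Real.exp (-b * t)),
    sq_nonneg (‖g t‖)]

theorem ENNReal.le_mul_of_le_rpow_half_mul {A D I : ℝ≥0∞} (hA : A ≠ ∞)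
    (h : A ≤ (D * A) ^ (1 / 2 : ℝ) * I ^ (1 / 2 : ℝ)) : A ≤ D * I := by
  rcases eq_or_ne A 0 with rfl | h0
  · exact zero_le
  have h2 : A ^ 2 ≤ D * I * A := by
    calc A ^ 2 ≤ ((D * A) ^ (1 / 2 : ℝ) * I ^ (1 / 2 : ℝ)) ^ 2 := by gcongr
      _ = D * I * A := by
        rw [mul_pow, ← ENNReal.rpow_two, ← ENNReal.rpow_two, ← ENNReal.rpow_mul,
          ← ENNReal.rpow_mul]
        norm_num
        ring
  rw [sq] at h2
  exact (ENNReal.mul_le_mul_iff_left h0 hA).1 h2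

/-- The `L²` Carleson embedding on a vertical strip. -/
theorem lintegral_laplace_sq_le {b : ℝ} (hb : 0 < b) {ν : Measure ℂ} {M : ℝ≥0∞} (hMt : M ≠ ∞)
    (hM : ∀ y : ℝ, ν {w : ℂ | y ≤ w.im ∧ w.im ≤ y + 4 * b} ≤ M)
    (hre : ∀ᵐ z ∂ν, b ≤ z.re ∧ z.re ≤ 3 * b) {g : ℝ → ℂ} (hg : Measurable g)
    (hg2 : ∫⁻ t in Ioi (0:ℝ), ‖g t‖ₑ ^ 2 ≠ ∞) :
    ∫⁻ z, ‖laplace g z‖ₑ ^ 2 ∂ν ≤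
      ENNReal.ofReal (stripConst b) * M * ∫⁻ t in Ioi (0:ℝ), ‖g t‖ₑ ^ 2 := by
  have hF := measurable_laplace hg
  set F := laplace g with hFdef
  set E : ℕ → Set ℂ := fun N =>
    {z | ENNReal.ofReal (1 / (N + 1)) ≤ ENNReal.ofReal (1 / (4 * b ^ 2 + (z.im - 0) ^ 2)) ∧
      ‖F z‖ ≤ N} with hE
  have hEm : ∀ N, MeasurableSet (E N) := fun N =>
    (measurableSet_le measurable_const (g := fun z : ℂ =>
      ENNReal.ofReal (1 / (4 * b ^ 2 + (z.im - 0) ^ 2))) (by fun_prop)).inter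
      (measurableSet_le hF.norm measurable_const)
  have hEU : ⋃ N, E N = univ := by
    refine eq_univ_of_forall fun z => mem_iUnion.2 ?_
    obtain ⟨N, hN⟩ := exists_nat_ge (max (4 * b ^ 2 + (z.im - 0) ^ 2) ‖F z‖)
    refine ⟨N, ENNReal.ofReal_le_ofReal ?_, (le_max_right _ _).trans hN⟩
    have := (le_max_left _ _).trans hN
    exact one_div_le_one_div_of_le (by positivity) (by linarith)
  have hEdir : Directed (· ⊆ ·) E := by
    refine directed_of_isDirected_le fun m n hmn z hz => ⟨le_trans ?_ hz.1, hz.2.trans ?_⟩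
    · gcongr
    · exact_mod_cast hmn
  have hEfin : ∀ N, ν (E N) < ∞ := fun N => by
    have h0 : ENNReal.ofReal (1 / ((N:ℝ) + 1)) ≠ 0 := by
      rw [Ne, ENNReal.ofReal_eq_zero, not_le]; positivity
    refine lt_of_le_of_lt (measure_mono fun z hz => hz.1)
      (lt_of_le_of_lt (meas_ge_le_lintegral_div (by fun_prop) h0 ENNReal.ofReal_ne_top)
        (ENNReal.div_lt_top ?_ h0))
    exact ((lintegral_poisson_le hb hM 0).trans_lt
      (ENNReal.mul_lt_top ENNReal.ofReal_lt_top hMt.lt_top)).ne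
  rw [← setLIntegral_univ, ← hEU, setLIntegral_iUnion_of_directed _ hEdir]
  refine iSup_le fun N => ?_
  set ρ := ν.restrict (E N) with hρ
  have : IsFiniteMeasure ρ := ⟨by rw [hρ, Measure.restrict_apply_univ]; exact hEfin N⟩
  have hρre : ∀ᵐ z ∂ρ, b ≤ z.re ∧ z.re ≤ 3 * b := ae_restrict_of_ae hre
  have hρN : ∀ᵐ z ∂ρ, ‖F z‖ ≤ N := by
    filter_upwards [ae_restrict_mem (hEm N)] with z hz using hz.2
  have hρM : ∀ y : ℝ, ρ {w : ℂ | y ≤ w.im ∧ w.im ≤ y + 4 * b} ≤ M := fun y =>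
    (Measure.restrict_apply_le _ _).trans (hM y)
  set φ : ℂ → ℂ := fun z => (starRingEnd ℂ) (F z) with hφ
  have hφm : Measurable φ := Complex.continuous_conj.measurable.comp hF
  have hφn : ∀ z, ‖φ z‖ₑ = ‖F z‖ₑ := fun z => RCLike.enorm_conj _
  have hφn' : ∀ z, ‖φ z‖ = ‖F z‖ := fun z => RCLike.norm_conj _
  have hdual := lintegral_adjoint_laplace_sq_le hb hρM hρre hφm
    (N := N) (by simpa only [hφn'] using hρN)
  simp only [hφn] at hdual
  set A := ∫⁻ z, ‖F z‖ₑ ^ 2 ∂ρ with hA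
  have hFi : Integrable (fun z => ‖F z‖ ^ 2) ρ := by
    refine (integrable_const ((N:ℝ) ^ 2)).mono' (by fun_prop) ?_
    filter_upwards [hρN] with z hz
    rw [Real.norm_of_nonneg (by positivity)]
    gcongr
  have hAeq : A = ‖∫ z, ((‖F z‖ ^ 2 : ℝ) : ℂ) ∂ρ‖ₑ := by
    rw [enorm_integral_ofReal_of_nonneg (fun z => by positivity) hFi]
    refine lintegral_congr fun z => ?_
    rw [ENNReal.ofReal_pow (norm_nonneg _), ofReal_norm]
  have hAt : A ≠ ∞ := by rw [hAeq]; exact enorm_ne_top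
  have hGm : Measurable fun t : ℝ => ∫ z, φ z * Complex.exp (-z * t) ∂ρ := by
    have : StronglyMeasurable
        (Function.uncurry fun (t : ℝ) (z : ℂ) => φ z * Complex.exp (-z * t)) := by
      have h : Measurable fun p : ℝ × ℂ => φ p.2 := hφm.comp measurable_snd
      exact (h.mul (by fun_prop : Measurable fun p : ℝ × ℂ =>
        Complex.exp (-p.2 * p.1))).stronglyMeasurable
    exact this.integral_prod_right.measurable
  have hint : Integrable (Function.uncurry fun (z : ℂ) (t : ℝ) =>
      φ z * (Complex.exp (-z * t) * g t)) (ρ.prod (volume.restrict (Ioi 0))) := by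
    have hbase := Integrable.mul_prod (integrable_const (μ := ρ) (N:ℝ))
      (integrableOn_exp_neg_mul_norm hb hg hg2)
    refine hbase.mono' ?_ ?_
    · have h1 : Measurable fun p : ℂ × ℝ => φ p.1 := hφm.comp measurable_fst
      have h2 : Measurable fun p : ℂ × ℝ => g p.2 := hg.comp measurable_snd
      exact (h1.mul ((by fun_prop : Measurable fun p : ℂ × ℝ =>
        Complex.exp (-p.1 * p.2)).mul h2)).aestronglyMeasurable
    · have a1 : ∀ᵐ p ∂(ρ.prod (volume.restrict (Ioi (0:ℝ)))), _ :=
        Measure.quasiMeasurePreserving_fst.ae (hρre.and hρN)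
      have a2 : ∀ᵐ p ∂(ρ.prod (volume.restrict (Ioi (0:ℝ)))), (0:ℝ) < p.2 :=
        Measure.quasiMeasurePreserving_snd.ae (ae_restrict_mem measurableSet_Ioi)
      filter_upwards [a1, a2] with p ⟨h1, h2⟩ ht
      rw [Function.uncurry_def]
      dsimp only
      rw [norm_mul, norm_mul, hφn', Complex.norm_exp, Complex.re_mul_ofReal, Complex.neg_re]
      gcongr
      exact h1.1
  have hswap : ∫ z, ((‖F z‖ ^ 2 : ℝ) : ℂ) ∂ρ =
      ∫ t in Ioi (0:ℝ), (∫ z, φ z * Complex.exp (-z * t) ∂ρ) * g t := by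
    calc ∫ z, ((‖F z‖ ^ 2 : ℝ) : ℂ) ∂ρ
        = ∫ z, (∫ t in Ioi (0:ℝ), φ z * (Complex.exp (-z * t) * g t)) ∂ρ := by
          refine integral_congr_ae (Eventually.of_forall fun z => ?_)
          dsimp only
          rw [integral_const_mul, ← Complex.normSq_eq_norm_sq, Complex.normSq_eq_conj_mul_self]
          rfl
      _ = ∫ t in Ioi (0:ℝ), (∫ z, φ z * (Complex.exp (-z * t) * g t) ∂ρ) :=
          integral_integral_swap hint
      _ = _ := by
          refine integral_congr_ae (Eventually.of_forall fun t => ?_)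
          dsimp only
          rw [← integral_mul_const]
          simp only [mul_assoc]
  refine ENNReal.le_mul_of_le_rpow_half_mul hAt ?_
  calc A ≤ ∫⁻ t in Ioi (0:ℝ), ‖∫ z, φ z * Complex.exp (-z * t) ∂ρ‖ₑ * ‖g t‖ₑ := by
        rw [hAeq, hswap]
        refine (enorm_integral_le_lintegral_enorm _).trans (le_of_eq ?_)
        simp only [enorm_mul]
    _ ≤ _ := ENNReal.lintegral_mul_le_Lp_mul_Lq _ Real.HolderConjugate.two_two
        hGm.enorm.aemeasurable hg.enorm.aemeasurable
    _ ≤ _ := by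
        simp only [ENNReal.rpow_two]
        gcongr

theorem norm_laplace_le {g : ℝ → ℂ} {z : ℂ} (hz : 0 ≤ z.re) :
    ‖laplace g z‖ₑ ≤ ∫⁻ t in Ioi (0:ℝ), ‖g t‖ₑ := by
  refine (enorm_integral_le_lintegral_enorm _).trans ?_
  refine setLIntegral_mono' measurableSet_Ioi fun t ht => ?_
  rw [enorm_mul]
  refine mul_le_of_le_one_left zero_le ?_
  rw [← ofReal_norm, Complex.norm_exp, Complex.re_mul_ofReal, Complex.neg_re]
  refine ENNReal.ofReal_le_one.2 (Real.exp_le_one_iff.2 ?_)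
  nlinarith [mul_nonneg hz (le_of_lt (mem_Ioi.1 ht))]

theorem laplace_add {g₁ g₂ : ℝ → ℂ} (hg₁ : Measurable g₁) {z : ℂ} (hz : 0 < z.re)
    (h₁ : ∫⁻ t in Ioi (0:ℝ), ‖g₁ t‖ₑ ^ 2 ≠ ∞) (h₂ : IntegrableOn g₂ (Ioi 0)) :
    laplace (fun t => g₁ t + g₂ t) z = laplace g₁ z + laplace g₂ z := by
  have hn : ∀ t : ℝ, ‖Complex.exp (-z * t)‖ = Real.exp (-z.re * t) := fun t => by
    rw [Complex.norm_exp, Complex.re_mul_ofReal, Complex.neg_re]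
  have i1 : IntegrableOn (fun t : ℝ => Complex.exp (-z * t) * g₁ t) (Ioi 0) := by
    refine (integrableOn_exp_neg_mul_norm hz hg₁ h₁).mono'
      ((by fun_prop : Measurable fun t : ℝ => Complex.exp (-z * t)).mul hg₁).aestronglyMeasurable
      (Eventually.of_forall fun t => ?_)
    rw [norm_mul, hn]
  have i2 : IntegrableOn (fun t : ℝ => Complex.exp (-z * t) * g₂ t) (Ioi 0) := by
    refine h₂.norm.mono'
      ((by fun_prop : Measurable fun t : ℝ =>
        Complex.exp (-z * t)).aestronglyMeasurable.mul h₂.aestronglyMeasurable) ?_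
    filter_upwards [ae_restrict_mem measurableSet_Ioi] with t ht
    rw [norm_mul, hn]
    refine mul_le_of_le_one_left (norm_nonneg _) (Real.exp_le_one_iff.2 ?_)
    nlinarith [mul_pos hz (mem_Ioi.1 ht)]
  simp only [laplace, mul_add]
  exact integral_add i1 i2

/-- Estimate of the distribution function of a Laplace transform on a vertical strip. -/
theorem measure_lt_norm_laplace_le {q : ℝ} (hq : 2 < q) {b : ℝ} (hb : 0 < b) {ν : Measure ℂ}
    {M : ℝ≥0∞} (hMt : M ≠ ∞)
    (hM : ∀ y : ℝ, ν {w : ℂ | y ≤ w.im ∧ w.im ≤ y + 4 * b} ≤ M)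
    (hre : ∀ᵐ z ∂ν, b ≤ z.re ∧ z.re ≤ 3 * b) {g : ℝ → ℂ} (hg : Measurable g)
    {P : ℝ} (hP : 0 < P)
    (hgP : ∫⁻ t in Ioi (0:ℝ), ENNReal.ofReal (‖g t‖ ^ (q / (q - 1))) ≤ ENNReal.ofReal P)
    {s : ℝ} (hs : 0 < s) :
    ν {z | s < ‖laplace g z‖} ≤ ENNReal.ofReal (4 / s ^ 2) *
      (ENNReal.ofReal (stripConst b) * M * ∫⁻ t in Ioi (0:ℝ),
        if ‖g t‖ ≤ (2 * P / s) ^ (q - 1) then ‖g t‖ₑ ^ 2 else 0) := by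
  set p := q / (q - 1) with hp
  set l := (2 * P / s) ^ (q - 1) with hl
  have hl0 : 0 < l := by positivity
  have hq1 : 0 < q - 1 := by linarith
  have hp1 : p - 1 = (q - 1)⁻¹ := by rw [hp]; field_simp; ring
  have hp0 : 0 < p - 1 := by rw [hp1]; positivity
  have hp2 : p ≤ 2 := by rw [hp, div_le_iff₀ hq1]; linarith
  have hlp : l ^ (p - 1) = 2 * P / s := by
    rw [hl, hp1, ← Real.rpow_mul (by positivity), mul_inv_cancel₀ hq1.ne', Real.rpow_one]
  set S := {t | ‖g t‖ ≤ l} with hS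
  have hSm : MeasurableSet S := measurableSet_le hg.norm measurable_const
  set g₁ := S.indicator g with hg1
  set g₂ := Sᶜ.indicator g with hg2
  have hg1m : Measurable g₁ := hg.indicator hSm
  have hg2m : Measurable g₂ := hg.indicator hSm.compl
  have hsum : g = fun t => g₁ t + g₂ t := (indicator_self_add_compl S g).symm
  have hg1sq : ∀ t, ‖g₁ t‖ₑ ^ 2 = if ‖g t‖ ≤ l then ‖g t‖ₑ ^ 2 else 0 := by
    intro t
    by_cases h : ‖g t‖ ≤ l
    · rw [if_pos h, hg1, indicator_of_mem (show t ∈ S from h)]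
    · rw [if_neg h, hg1, indicator_of_notMem (show t ∉ S from h)]; simp
  have hfin1 : ∫⁻ t in Ioi (0:ℝ), ‖g₁ t‖ₑ ^ 2 ≠ ∞ := by
    have : ∫⁻ t in Ioi (0:ℝ), ‖g₁ t‖ₑ ^ 2 ≤
        ENNReal.ofReal (l ^ (2 - p)) *
          ∫⁻ t in Ioi (0:ℝ), ENNReal.ofReal (‖g t‖ ^ p) := by
      rw [← lintegral_const_mul' _ _ ENNReal.ofReal_ne_top]
      refine lintegral_mono fun t => ?_
      dsimp only
      rw [hg1sq]
      split_ifs with h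
      · rw [← ENNReal.ofReal_mul (by positivity), ← ofReal_norm,
          ← ENNReal.ofReal_pow (norm_nonneg _)]
        refine ENNReal.ofReal_le_ofReal ?_
        have e : ‖g t‖ ^ 2 = ‖g t‖ ^ (2 - p) * ‖g t‖ ^ p := by
          rw [← Real.rpow_add_of_nonneg (norm_nonneg _) (by linarith) (by linarith)]
          norm_num
        rw [e]
        have : 0 ≤ 2 - p := by linarith
        gcongr
      · exact zero_le
    refine (this.trans_lt (ENNReal.mul_lt_top ENNReal.ofReal_lt_top ?_)).ne
    exact hgP.trans_lt ENNReal.ofReal_lt_top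
  have hl1 : ∫⁻ t in Ioi (0:ℝ), ‖g₂ t‖ₑ ≤ ENNReal.ofReal (s / 2) := by
    calc ∫⁻ t in Ioi (0:ℝ), ‖g₂ t‖ₑ
        ≤ ENNReal.ofReal (s / (2 * P)) *
          ∫⁻ t in Ioi (0:ℝ), ENNReal.ofReal (‖g t‖ ^ p) := by
          rw [← lintegral_const_mul' _ _ ENNReal.ofReal_ne_top]
          refine lintegral_mono fun t => ?_
          dsimp only
          by_cases h : ‖g t‖ ≤ l
          · rw [hg2, indicator_of_notMem (fun h' : t ∈ Sᶜ => h' h)]; simp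
          · rw [hg2, indicator_of_mem (show t ∈ Sᶜ from h),
              ← ENNReal.ofReal_mul (by positivity), ← ofReal_norm]
            refine ENNReal.ofReal_le_ofReal ?_
            push Not at h
            have h0 : 0 < ‖g t‖ := hl0.trans h
            have e : ‖g t‖ ^ p = ‖g t‖ ^ (p - 1) * ‖g t‖ := by
              rw [← Real.rpow_add_one h0.ne']; ring_nf
            have k : 2 * P / s ≤ ‖g t‖ ^ (p - 1) := by rw [← hlp]; gcongr
            calc ‖g t‖ = s / (2 * P) * (2 * P / s * ‖g t‖) := by field_simp
              _ ≤ s / (2 * P) * (‖g t‖ ^ (p - 1) * ‖g t‖) := by gcongr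
              _ = _ := by rw [e]
      _ ≤ ENNReal.ofReal (s / (2 * P)) * ENNReal.ofReal P := by gcongr
      _ = ENNReal.ofReal (s / 2) := by
          rw [← ENNReal.ofReal_mul (by positivity)]; congr 1; field_simp
  have hi2 : IntegrableOn g₂ (Ioi 0) :=
    ⟨hg2m.aestronglyMeasurable, by
      rw [hasFiniteIntegral_iff_enorm]; exact hl1.trans_lt ENNReal.ofReal_lt_top⟩
  have hsub : ν {z | s < ‖laplace g z‖} ≤
      ν {z | ENNReal.ofReal ((s / 2) ^ 2) ≤ ‖laplace g₁ z‖ₑ ^ 2} := by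
    refine measure_mono_ae ?_
    filter_upwards [hre] with z ⟨hz, _⟩ (hsz : s < ‖laplace g z‖)
    have hz0 : 0 < z.re := hb.trans_le hz
    change ENNReal.ofReal ((s / 2) ^ 2) ≤ ‖laplace g₁ z‖ₑ ^ 2
    rw [hsum, laplace_add hg1m hz0 hfin1 hi2] at hsz
    have h2 : ‖laplace g₂ z‖ ≤ s / 2 := by
      have := (norm_laplace_le hz0.le).trans hl1
      rwa [← ofReal_norm, ENNReal.ofReal_le_ofReal_iff (by positivity)] at this
    have h1 : s / 2 ≤ ‖laplace g₁ z‖ := by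
      have := norm_add_le (laplace g₁ z) (laplace g₂ z)
      linarith
    rw [← ofReal_norm, ← ENNReal.ofReal_pow (norm_nonneg _)]
    exact ENNReal.ofReal_le_ofReal (by gcongr)
  have hs0 : ENNReal.ofReal ((s / 2) ^ 2) ≠ 0 := by
    rw [Ne, ENNReal.ofReal_eq_zero, not_le]; positivity
  refine hsub.trans ((meas_ge_le_lintegral_div
    ((measurable_laplace hg1m).enorm.pow_const 2).aemeasurable hs0
    ENNReal.ofReal_ne_top).trans ?_)
  have hL := lintegral_laplace_sq_le hb hMt hM hre hg1m hfin1
  rw [ENNReal.div_eq_inv_mul, ← ENNReal.ofReal_inv_of_pos (by positivity)]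
  simp only [hg1sq] at hL
  gcongr
  exact le_of_eq (by field_simp; norm_num)

theorem lintegral_Ioc_rpow {r σ : ℝ} (hr : -1 < r) (hσ : 0 ≤ σ) :
    ∫⁻ s in Ioc 0 σ, ENNReal.ofReal (s ^ r) = ENNReal.ofReal (σ ^ (r + 1) / (r + 1)) := by
  rw [← ofReal_integral_eq_lintegral_ofReal]
  · rw [← intervalIntegral.integral_of_le hσ, integral_rpow (Or.inl hr),
      Real.zero_rpow (by linarith), sub_zero]
  · exact (intervalIntegrable_iff_integrableOn_Ioc_of_le hσ).1
      (intervalIntegral.intervalIntegrable_rpow' hr)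
  · filter_upwards [ae_restrict_mem measurableSet_Ioc] with s hs
    exact Real.rpow_nonneg hs.1.le _

/-- The constant in the `L^{q'} → L^q` Carleson embedding on a vertical strip. -/
def interpConst (q : ℝ) : ℝ := 1 + q * (4 * (2 ^ (q - 2) / (q - 2)))

theorem interpConst_pos {q : ℝ} (hq : 2 ≤ q) : 0 < interpConst q := by
  have : 0 ≤ q - 2 := by linarith
  have : 0 ≤ q := by linarith
  unfold interpConst
  positivity

/-- The `L^{q'} → L^q` Carleson embedding on a vertical strip. -/
theorem lintegral_laplace_rpow_le {q : ℝ} (hq : 2 ≤ q) {b : ℝ} (hb : 0 < b) {ν : Measure ℂ}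
    {M : ℝ≥0∞} (hMt : M ≠ ∞)
    (hM : ∀ y : ℝ, ν {w : ℂ | y ≤ w.im ∧ w.im ≤ y + 4 * b} ≤ M)
    (hre : ∀ᵐ z ∂ν, b ≤ z.re ∧ z.re ≤ 3 * b) {g : ℝ → ℂ} (hg : Measurable g)
    {P : ℝ} (hP : 0 < P)
    (hgP : ∫⁻ t in Ioi (0:ℝ), ENNReal.ofReal (‖g t‖ ^ (q / (q - 1))) ≤ ENNReal.ofReal P) :
    ∫⁻ z, ‖laplace g z‖ₑ ^ q ∂ν ≤
      ENNReal.ofReal (interpConst q) * (ENNReal.ofReal (stripConst b) * M) *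
        ENNReal.ofReal (P ^ (q - 1)) := by
  set D := ENNReal.ofReal (stripConst b) * M with hD
  have hDt : D ≠ ∞ := ENNReal.mul_ne_top ENNReal.ofReal_ne_top hMt
  rcases hq.eq_or_lt with rfl | hq
  · have e : ∀ t, ENNReal.ofReal (‖g t‖ ^ ((2:ℝ) / (2 - 1))) = ‖g t‖ₑ ^ 2 := fun t => by
      rw [← ofReal_norm, ← ENNReal.ofReal_pow (norm_nonneg _)]; norm_num
    simp only [e] at hgP
    have := lintegral_laplace_sq_le hb hMt hM hre hg (hgP.trans_lt ENNReal.ofReal_lt_top).ne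
    simp only [ENNReal.rpow_two, interpConst]
    norm_num
    exact this.trans (by gcongr)
  have hq1 : 0 < q - 1 := by linarith
  have hq2 : 0 < q - 2 := by linarith
  set p := q / (q - 1) with hp
  have hp1 : p - 1 = (q - 1)⁻¹ := by rw [hp]; field_simp; ring
  have hp0 : 0 < p - 1 := by rw [hp1]; positivity
  set K : ℝ → ℝ → ℝ≥0∞ := fun s t =>
    ENNReal.ofReal (s ^ (q - 3)) * if ‖g t‖ ≤ (2 * P / s) ^ (q - 1) then ‖g t‖ₑ ^ 2 else 0 with hK
  have hKm : Measurable (Function.uncurry K) := by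
    have h1 : Measurable fun x : ℝ × ℝ => ‖g x.2‖ := (hg.comp measurable_snd).norm
    have h2 : Measurable fun x : ℝ × ℝ => ‖g x.2‖ₑ ^ 2 :=
      ((hg.comp measurable_snd).enorm).pow_const 2
    have h3 : Measurable fun x : ℝ × ℝ => (2 * P / x.1) ^ (q - 1) := by fun_prop
    exact (by fun_prop : Measurable fun x : ℝ × ℝ => ENNReal.ofReal (x.1 ^ (q - 3))).mul
      (Measurable.ite (measurableSet_le h1 h3) h2 measurable_const)
  have hinner : ∀ t, ∫⁻ s in Ioi (0:ℝ), K s t ≤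
      ENNReal.ofReal ((2 * P) ^ (q - 2) / (q - 2)) * ENNReal.ofReal (‖g t‖ ^ p) := by
    intro t
    rcases (norm_nonneg (g t)).eq_or_lt with h0 | h0
    · have : g t = 0 := norm_eq_zero.1 h0.symm
      simp [hK, this]
    set σ := 2 * P / ‖g t‖ ^ (p - 1) with hσ
    have hσ0 : 0 < σ := by positivity
    have hle : ∀ s ∈ Ioi (0:ℝ), K s t ≤
        (Ioc 0 σ).indicator (fun s => ‖g t‖ₑ ^ 2 * ENNReal.ofReal (s ^ (q - 3))) s := by
      intro s hs
      have hs : 0 < s := hs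
      simp only [hK]
      split_ifs with h
      · rw [indicator_of_mem, mul_comm]
        refine ⟨hs, ?_⟩
        have k : ‖g t‖ ^ (p - 1) ≤ 2 * P / s := by
          calc ‖g t‖ ^ (p - 1) ≤ ((2 * P / s) ^ (q - 1)) ^ (p - 1) := by gcongr
            _ = 2 * P / s := by
              rw [hp1, ← Real.rpow_mul (by positivity), mul_inv_cancel₀ hq1.ne', Real.rpow_one]
        rw [le_div_iff₀ hs] at k
        rw [hσ, le_div_iff₀ (by positivity)]
        linarith
      · simp
    calc ∫⁻ s in Ioi (0:ℝ), K s t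
        ≤ ∫⁻ s in Ioi (0:ℝ),
          (Ioc 0 σ).indicator (fun s => ‖g t‖ₑ ^ 2 * ENNReal.ofReal (s ^ (q - 3))) s :=
          setLIntegral_mono' measurableSet_Ioi hle
      _ ≤ ∫⁻ s, (Ioc 0 σ).indicator (fun s => ‖g t‖ₑ ^ 2 * ENNReal.ofReal (s ^ (q - 3))) s :=
          setLIntegral_le_lintegral _ _
      _ = ‖g t‖ₑ ^ 2 * ENNReal.ofReal (σ ^ (q - 2) / (q - 2)) := by
          rw [lintegral_indicator measurableSet_Ioc, lintegral_const_mul _ (by fun_prop),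
            lintegral_Ioc_rpow (by linarith) hσ0.le]
          ring_nf
      _ = _ := by
          rw [← ofReal_norm, ← ENNReal.ofReal_pow (norm_nonneg _),
            ← ENNReal.ofReal_mul (by positivity), ← ENNReal.ofReal_mul (by positivity)]
          congr 1
          have e : ‖g t‖ ^ p * (‖g t‖ ^ (p - 1)) ^ (q - 2) = ‖g t‖ ^ 2 := by
            rw [← Real.rpow_mul h0.le, ← Real.rpow_add h0, ← Real.rpow_natCast]
            congr 1
            rw [hp]; field_simp; push_cast; ring
          rw [hσ, Real.div_rpow (by positivity) (by positivity), ← e]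
          field_simp
  have hdist : ∀ s ∈ Ioi (0:ℝ), ν {z | s < ‖laplace g z‖} * ENNReal.ofReal (s ^ (q - 1)) ≤
      4 * D * ∫⁻ t in Ioi (0:ℝ), K s t := by
    intro s hs
    have hs : 0 < s := hs
    have h := measure_lt_norm_laplace_le hq hb hMt hM hre hg hP hgP hs
    simp only [hK]
    rw [lintegral_const_mul' _ _ ENNReal.ofReal_ne_top]
    have e : ENNReal.ofReal (4 / s ^ 2) * ENNReal.ofReal (s ^ (q - 1)) =
        4 * ENNReal.ofReal (s ^ (q - 3)) := by
      rw [← ENNReal.ofReal_mul (by positivity), ← ENNReal.ofReal_ofNat 4,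
        ← ENNReal.ofReal_mul (by positivity)]
      congr 1
      rw [show q - 1 = (q - 3) + (2:ℕ) by push_cast; ring, Real.rpow_add_natCast hs.ne']
      field_simp
    set J := ∫⁻ t in Ioi (0:ℝ), if ‖g t‖ ≤ (2 * P / s) ^ (q - 1) then ‖g t‖ₑ ^ 2 else 0
    calc _ ≤ ENNReal.ofReal (4 / s ^ 2) * (D * J) * ENNReal.ofReal (s ^ (q - 1)) := by gcongr
      _ = ENNReal.ofReal (4 / s ^ 2) * ENNReal.ofReal (s ^ (q - 1)) * (D * J) := by ring
      _ = _ := by rw [e]; ring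
  have hq0 : 0 < q := by linarith
  calc ∫⁻ z, ‖laplace g z‖ₑ ^ q ∂ν
      = ∫⁻ z, ENNReal.ofReal (‖laplace g z‖ ^ q) ∂ν := by
        refine lintegral_congr fun z => ?_
        rw [← ofReal_norm, ENNReal.ofReal_rpow_of_nonneg (norm_nonneg _) hq0.le]
    _ = ENNReal.ofReal q *
        ∫⁻ s in Ioi (0:ℝ), ν {z | s < ‖laplace g z‖} * ENNReal.ofReal (s ^ (q - 1)) :=
        lintegral_rpow_eq_lintegral_meas_lt_mul ν (Eventually.of_forall fun z => norm_nonneg _)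
          (measurable_laplace hg).norm.aemeasurable hq0
    _ ≤ ENNReal.ofReal q * ∫⁻ s in Ioi (0:ℝ), 4 * D * ∫⁻ t in Ioi (0:ℝ), K s t := by
        gcongr ENNReal.ofReal q * ?_
        exact setLIntegral_mono' measurableSet_Ioi hdist
    _ = ENNReal.ofReal q * (4 * D * ∫⁻ t in Ioi (0:ℝ), ∫⁻ s in Ioi (0:ℝ), K s t) := by
        rw [lintegral_const_mul' _ _ (ENNReal.mul_ne_top (by norm_num) hDt),
          lintegral_lintegral_swap hKm.aemeasurable]
    _ ≤ ENNReal.ofReal q * (4 * D *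
          (ENNReal.ofReal ((2 * P) ^ (q - 2) / (q - 2)) * ENNReal.ofReal P)) := by
        gcongr
        refine (lintegral_mono hinner).trans ?_
        rw [lintegral_const_mul' _ _ ENNReal.ofReal_ne_top]
        gcongr
    _ = ENNReal.ofReal (q * (4 * (2 ^ (q - 2) / (q - 2)))) * D *
          ENNReal.ofReal (P ^ (q - 1)) := by
        have e : (2 * P) ^ (q - 2) / (q - 2) * P = 2 ^ (q - 2) / (q - 2) * P ^ (q - 1) := by
          rw [Real.mul_rpow zero_le_two hP.le, show q - 1 = q - 2 + 1 by ring,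
            Real.rpow_add_one hP.ne']
          ring
        rw [← ENNReal.ofReal_mul (by positivity), e, ENNReal.ofReal_mul (by positivity),
          ENNReal.ofReal_mul hq0.le, ENNReal.ofReal_mul (by norm_num), ENNReal.ofReal_ofNat]
        ring
    _ ≤ _ := by
        gcongr
        unfold interpConst
        linarith

theorem YoungFunction.bddAbove {Φ : ℝ → ℝ} (hΦ : YoungFunction Φ) (s : ℝ) :
    BddAbove {u : ℝ | ∃ t : ℝ, 0 ≤ t ∧ u = s * t - Φ t} := by
  obtain ⟨h0, -, -, -, -, hinf⟩ := hΦ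
  obtain ⟨T, hT0, hT⟩ := ((hinf.eventually_ge_atTop s).exists_forall_of_atTop).imp
    fun T hT => (⟨le_max_right T 1, fun t ht => hT t ((le_max_left _ _).trans ht)⟩ :
      1 ≤ max T 1 ∧ ∀ t ≥ max T 1, s ≤ Φ t / t)
  refine ⟨|s| * max T 1, ?_⟩
  rintro u ⟨t, ht, rfl⟩
  have hs := le_abs_self s
  have hs0 := abs_nonneg s
  rcases le_total (max T 1) t with h | h
  · have h1 := hT t h
    rw [le_div_iff₀ (by linarith)] at h1
    have : 0 ≤ |s| * max T 1 := by positivity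
    linarith
  · have h1 := h0 t ht
    have : s * t ≤ |s| * max T 1 := by gcongr
    linarith

theorem YoungFunction.mul_le_add_youngConj {Φ : ℝ → ℝ} (hΦ : YoungFunction Φ) (s : ℝ) {t : ℝ}
    (ht : 0 ≤ t) : s * t ≤ Φ t + youngConj Φ s := by
  have : s * t - Φ t ≤ youngConj Φ s := le_csSup (hΦ.bddAbove s) ⟨t, ht, rfl⟩
  linarith

theorem YoungFunction.luxNorm_youngConj_exp_ne_zero {Φ : ℝ → ℝ} (hΦ : YoungFunction Φ) {c : ℝ}
    (hc : 0 < c) :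
    luxNorm (youngConj Φ) (Ioi 0) (fun t => ((Real.exp (-c * t) : ℝ) : ℂ)) ≠ 0 := by
  have h1 : 0 ≤ Φ 1 := hΦ.1 1 zero_le_one
  have hpos : 0 < ENNReal.ofReal (Real.exp (-c) / (1 + Φ 1)) := by
    rw [ENNReal.ofReal_pos]; positivity
  refine (hpos.trans_le ?_).ne'
  refine le_iInf fun k => le_iInf fun hk => le_iInf fun hint => ENNReal.ofReal_le_ofReal ?_
  have hle : ENNReal.ofReal (Real.exp (-c) / k - Φ 1) ≤ 1 := by
    calc ENNReal.ofReal (Real.exp (-c) / k - Φ 1)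
        = ∫⁻ t in Ioc (0:ℝ) 1, ENNReal.ofReal (Real.exp (-c) / k - Φ 1) := by simp
      _ ≤ ∫⁻ t in Ioc (0:ℝ) 1,
            ENNReal.ofReal (youngConj Φ (‖((Real.exp (-c * t) : ℝ) : ℂ)‖ / k)) := by
          refine setLIntegral_mono' measurableSet_Ioc fun t ht => ENNReal.ofReal_le_ofReal ?_
          rw [Complex.norm_real, Real.norm_of_nonneg (Real.exp_nonneg _)]
          have := hΦ.mul_le_add_youngConj (Real.exp (-c * t) / k) zero_le_one
          have hexp : Real.exp (-c) / k ≤ Real.exp (-c * t) / k := by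
            gcongr
            nlinarith [ht.2]
          linarith
      _ ≤ _ := lintegral_mono_set Ioc_subset_Ioi_self
      _ ≤ 1 := hint
  rw [ENNReal.ofReal_le_one, sub_le_iff_le_add, div_le_iff₀ hk] at hle
  rw [div_le_iff₀ (by positivity)]
  linarith

/-- Hölder's inequality in Orlicz spaces, for an exponential weight. -/
theorem YoungFunction.lintegral_rpow_norm_exp_mul_le {Φ : ℝ → ℝ} (hΦ : YoungFunction Φ) {p b : ℝ}
    (hp : 0 ≤ p) {f : ℝ → ℂ} (hf : Measurable f)
    (hfΦ : luxNorm (fun t => Φ (t ^ p)) (Ioi 0) f ≤ 1) {k : ℝ} (hk : 0 < k)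
    (hint : ∫⁻ t in Ioi (0:ℝ),
      ENNReal.ofReal (youngConj Φ (‖((Real.exp (-p * b * t) : ℝ) : ℂ)‖ / k)) ≤ 1) :
    ∫⁻ t in Ioi (0:ℝ), ENNReal.ofReal (‖(Real.exp (-b * t) : ℂ) * f t‖ ^ p) ≤
      ENNReal.ofReal (2 * 2 ^ p * k) := by
  have hmono := hΦ.2.1
  have hcont := hΦ.2.2.1
  have hf2 : ∫⁻ t in Ioi (0:ℝ), ENNReal.ofReal (Φ ((‖f t‖ / 2) ^ p)) ≤ 1 := by
    have hlt := hfΦ.trans_lt (by norm_num : (1:ℝ≥0∞) < 2)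
    simp only [luxNorm, iInf_lt_iff] at hlt
    obtain ⟨k₀, hk0, hk1, hk2⟩ := hlt
    have hk2 : k₀ ≤ 2 := by
      rw [← ENNReal.ofReal_ofNat, ENNReal.ofReal_lt_ofReal_iff (by norm_num)] at hk2
      exact hk2.le
    refine le_trans (lintegral_mono fun t => ENNReal.ofReal_le_ofReal ?_) hk1
    refine hmono (mem_Ici.2 (by positivity)) (mem_Ici.2 (by positivity)) ?_
    gcongr
  have hm : Measurable fun t => ENNReal.ofReal (Φ ((‖f t‖ / 2) ^ p)) := by
    have hc : Continuous fun x : ℝ => Φ (max x 0) :=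
      hcont.comp_continuous (by fun_prop) fun x => mem_Ici.2 (le_max_right _ _)
    have := hc.measurable.comp (show Measurable fun t => (‖f t‖ / 2) ^ p by fun_prop)
    have e : (fun t => Φ ((‖f t‖ / 2) ^ p)) =
        (fun x => Φ (max x 0)) ∘ fun t => (‖f t‖ / 2) ^ p := by
      funext t
      rw [Function.comp_apply, max_eq_left (by positivity)]
    rw [← e] at this
    exact this.ennreal_ofReal
  calc ∫⁻ t in Ioi (0:ℝ), ENNReal.ofReal (‖(Real.exp (-b * t) : ℂ) * f t‖ ^ p)
      ≤ ∫⁻ t in Ioi (0:ℝ), ENNReal.ofReal (2 ^ p * k) *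
          (ENNReal.ofReal (Φ ((‖f t‖ / 2) ^ p)) +
            ENNReal.ofReal (youngConj Φ (‖((Real.exp (-p * b * t) : ℝ) : ℂ)‖ / k))) := by
        refine lintegral_mono fun t => ?_
        dsimp only
        have hy := hΦ.mul_le_add_youngConj (Real.exp (-p * b * t) / k)
          (t := (‖f t‖ / 2) ^ p) (by positivity)
        refine le_trans ?_ (mul_le_mul_right ENNReal.ofReal_add_le _)
        rw [← ENNReal.ofReal_mul (by positivity)]
        refine ENNReal.ofReal_le_ofReal ?_
        rw [Complex.norm_real, Real.norm_of_nonneg (Real.exp_nonneg _), norm_mul,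
          Complex.norm_real, Real.norm_of_nonneg (Real.exp_nonneg _),
          Real.mul_rpow (Real.exp_nonneg _) (norm_nonneg _), ← Real.exp_mul]
        refine le_trans (le_of_eq ?_) (mul_le_mul_of_nonneg_left hy (by positivity))
        rw [Real.div_rpow (norm_nonneg _) zero_le_two, show -b * t * p = -p * b * t by ring]
        field_simp
    _ ≤ ENNReal.ofReal (2 ^ p * k) * (1 + 1) := by
        rw [lintegral_const_mul' _ _ ENNReal.ofReal_ne_top, lintegral_add_left hm]
        gcongr
    _ = _ := by
        rw [one_add_one_eq_two, ← ENNReal.ofReal_ofNat 2, ← ENNReal.ofReal_mul (by positivity)]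
        congr 1
        ring

theorem laplace_eq_laplace_sub (f : ℝ → ℂ) (b : ℝ) (z : ℂ) :
    laplace f z = laplace (fun t => (Real.exp (-b * t) : ℂ) * f t) (z - b) := by
  unfold laplace
  congr 1
  funext t
  dsimp only
  rw [Complex.ofReal_exp, ← mul_assoc, ← Complex.exp_add]
  congr 2
  push_cast
  ring

theorem measurableSet_dyadicStrip (n : ℤ) : MeasurableSet (dyadicStrip n) :=
  (measurableSet_le measurable_const Complex.measurable_re).inter
    (measurableSet_lt Complex.measurable_re measurable_const)

theorem measure_carlesonSquare_le (α : ℝ) (ν : Measure ℂ) {a b : ℝ} (hab : a < b) :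
    ν (carlesonSquare a b) ≤ carlesonIntensity α ν * ENNReal.ofReal ((b - a) ^ α) := by
  have h : 0 < (b - a) ^ α := Real.rpow_pos_of_pos (sub_pos.2 hab) _
  rw [← ENNReal.div_le_iff (by rwa [Ne, ENNReal.ofReal_eq_zero, not_le]) ENNReal.ofReal_ne_top]
  exact le_iSup_of_le a (le_iSup_of_le b (le_iSup_of_le hab le_rfl))

theorem stripPart_eq_zero {α : ℝ} {μ : Measure ℂ} {n : ℤ}
    (h : carlesonIntensity α (stripPart μ n) = 0) : stripPart μ n = 0 := by
  rw [← Measure.measure_univ_eq_zero]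
  have hsub : (univ : Set ℂ) ⊆
      (⋃ N : ℕ, carlesonSquare (-(N + 1)) (N + 1)) ∪ (dyadicStrip n)ᶜ := by
    intro z _
    by_cases hz : z ∈ dyadicStrip n
    · left
      obtain ⟨N, hN⟩ := exists_nat_ge ‖z‖
      have hre := (Complex.re_le_norm z).trans hN
      have him := abs_le.1 ((Complex.abs_im_le_norm z).trans hN)
      have h0 : 0 < z.re := (zpow_pos two_pos n).trans_le hz.1
      exact mem_iUnion.2 ⟨N, ⟨by linarith, by linarith⟩, h0, by linarith⟩
    · exact Or.inr hz
  refine measure_mono_null hsub (measure_union_null (measure_iUnion_null fun N => ?_) ?_)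
  · have := measure_carlesonSquare_le α (stripPart μ n)
      (show -((N:ℝ) + 1) < N + 1 by linarith [N.cast_nonneg (α := ℝ)])
    rw [h, zero_mul] at this
    exact le_antisymm this zero_le
  · rw [stripPart, Measure.restrict_apply (measurableSet_dyadicStrip n).compl,
      compl_inter_self, measure_empty]

/-- The constant in the Laplace–Carleson embedding theorem. -/
def embeddingConst (q : ℝ) : ℝ :=
  interpConst q * (3 / 2 * Real.exp 6 * latticeConst) * 4 ^ q *
    (2 * 2 ^ (q / (q - 1))) ^ (q - 1)

theorem embeddingConst_pos {q : ℝ} (hq : 2 ≤ q) : 0 < embeddingConst q := by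
  have := interpConst_pos hq
  have := latticeConst_pos
  unfold embeddingConst
  positivity

/-- The contribution of a single dyadic strip. -/
theorem setLIntegral_dyadicStrip_le {q : ℝ} (hq : 2 ≤ q) {Φ : ℝ → ℝ} (hΦ : YoungFunction Φ)
    (μ : Measure ℂ) {f : ℝ → ℂ} (hf : Measurable f)
    (hfΦ : luxNorm (fun t => Φ (t ^ (q / (q - 1)))) (Ioi 0) f ≤ 1) (n : ℤ) :
    ∫⁻ z in dyadicStrip n, ‖laplace f z‖ₑ ^ q ∂μ ≤ ENNReal.ofReal (embeddingConst q) *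
      (((2:ℝ≥0∞) ^ n * luxNorm (youngConj Φ) (Ioi 0)
        (fun t => ((Real.exp (-(q / (q - 1)) * (2:ℝ) ^ (n - 1) * t) : ℝ) : ℂ))) ^ (q - 1) *
          carlesonIntensity q (stripPart μ n)) := by
  have hq1 : 0 < q - 1 := by linarith
  set p := q / (q - 1) with hp
  have hp0 : 0 < p := by positivity
  set b : ℝ := (2:ℝ) ^ (n - 1) with hb
  have hb0 : 0 < b := by positivity
  have h2b : (2:ℝ) ^ n = 2 * b := by
    rw [hb, zpow_sub_one₀ two_ne_zero]; ring
  have h4b : (2:ℝ) ^ (n + 1) = 4 * b := by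
    rw [zpow_add_one₀ two_ne_zero, h2b]; ring
  have h2n : (2:ℝ≥0∞) ^ n = ENNReal.ofReal (2 * b) := by
    rw [← h2b, ← ENNReal.rpow_intCast, ← Real.rpow_intCast, ← ENNReal.ofReal_rpow_of_pos two_pos,
      ENNReal.ofReal_ofNat]
  set L := luxNorm (youngConj Φ) (Ioi 0)
    (fun t => ((Real.exp (-p * b * t) : ℝ) : ℂ)) with hL
  set Q := carlesonIntensity q (stripPart μ n) with hQ
  have hC := embeddingConst_pos hq
  have hL0 : L ≠ 0 := by
    have := hΦ.luxNorm_youngConj_exp_ne_zero (c := p * b) (by positivity)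
    rw [hL]
    simpa only [neg_mul] using this
  have h2n0 : (2:ℝ≥0∞) ^ n ≠ 0 := by
    rw [h2n, Ne, ENNReal.ofReal_eq_zero, not_le]; positivity
  have hC0 : ENNReal.ofReal (embeddingConst q) ≠ 0 := by
    rwa [Ne, ENNReal.ofReal_eq_zero, not_le]
  have hpow0 : ((2:ℝ≥0∞) ^ n * L) ^ (q - 1) ≠ 0 := by
    rw [Ne, ENNReal.rpow_eq_zero_iff_of_pos hq1]
    exact mul_ne_zero h2n0 hL0
  rcases eq_or_ne Q 0 with hQ0 | hQ0
  · have : μ.restrict (dyadicStrip n) = 0 := stripPart_eq_zero hQ0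
    rw [this, lintegral_zero_measure]
    exact zero_le
  rcases eq_or_ne Q ∞ with hQt | hQt
  · rw [hQt, ENNReal.mul_top hpow0, ENNReal.mul_top hC0]
    exact le_top
  rcases eq_or_ne L ∞ with hLt | hLt
  · rw [hLt, ENNReal.mul_top h2n0, ENNReal.top_rpow_of_pos hq1, ENNReal.top_mul hQ0,
      ENNReal.mul_top hC0]
    exact le_top
  obtain ⟨l, hl0, hl⟩ : ∃ l : ℝ, 0 < l ∧ L = ENNReal.ofReal l :=
    ⟨L.toReal, ENNReal.toReal_pos hL0 hLt, (ENNReal.ofReal_toReal hLt).symm⟩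
  obtain ⟨k, hk0, hk1, hk2⟩ : ∃ k : ℝ, 0 < k ∧ (∫⁻ t in Ioi (0:ℝ),
      ENNReal.ofReal (youngConj Φ (‖((Real.exp (-p * b * t) : ℝ) : ℂ)‖ / k)) ≤ 1) ∧
        k ≤ 2 * l := by
    have hlt : L < ENNReal.ofReal (2 * l) := by
      rw [hl, ENNReal.ofReal_lt_ofReal_iff (by positivity)]; linarith
    rw [hL] at hlt
    simp only [luxNorm, iInf_lt_iff] at hlt
    obtain ⟨k, hk0, hk1, hk2⟩ := hlt
    exact ⟨k, hk0, hk1, ((ENNReal.ofReal_lt_ofReal_iff (by positivity)).1 hk2).le⟩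
  set g : ℝ → ℂ := fun t => (Real.exp (-b * t) : ℂ) * f t with hg
  have hgm : Measurable g :=
    (by fun_prop : Measurable fun t : ℝ => (Real.exp (-b * t) : ℂ)).mul hf
  have hgP : ∫⁻ t in Ioi (0:ℝ), ENNReal.ofReal (‖g t‖ ^ p) ≤
      ENNReal.ofReal (2 * 2 ^ p * (2 * l)) :=
    (hΦ.lintegral_rpow_norm_exp_mul_le hp0.le hf hfΦ hk0 hk1).trans
      (ENNReal.ofReal_le_ofReal (by gcongr))
  have hsubm : Measurable fun z : ℂ => z - (b:ℂ) := by fun_prop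
  set ρ := (stripPart μ n).map (fun z => z - (b:ℂ)) with hρ
  have hρre : ∀ᵐ z ∂ρ, b ≤ z.re ∧ z.re ≤ 3 * b := by
    rw [hρ, ae_map_iff (p := fun z : ℂ => b ≤ z.re ∧ z.re ≤ 3 * b) hsubm.aemeasurable
      ((measurableSet_le measurable_const Complex.measurable_re).inter
        (measurableSet_le Complex.measurable_re measurable_const))]
    filter_upwards [ae_restrict_mem (measurableSet_dyadicStrip n)] with z hz
    obtain ⟨h1, h2⟩ := hz
    rw [h2b] at h1
    rw [h4b] at h2
    rw [Complex.sub_re, Complex.ofReal_re]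
    constructor <;> linarith
  have hρM : ∀ y : ℝ, ρ {w : ℂ | y ≤ w.im ∧ w.im ≤ y + 4 * b} ≤
      Q * ENNReal.ofReal ((4 * b) ^ q) := by
    intro y
    have hslab : MeasurableSet {w : ℂ | y ≤ w.im ∧ w.im ≤ y + 4 * b} :=
      (measurableSet_le measurable_const Complex.measurable_im).inter
        (measurableSet_le Complex.measurable_im measurable_const)
    rw [hρ, Measure.map_apply hsubm hslab]
    have h := measure_carlesonSquare_le q (stripPart μ n)
      (show y < y + 4 * b by linarith)
    rw [add_sub_cancel_left] at h
    refine le_trans (measure_mono_ae ?_) h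
    filter_upwards [ae_restrict_mem (measurableSet_dyadicStrip n)] with z hz
      (hzs : y ≤ (z - (b:ℂ)).im ∧ (z - (b:ℂ)).im ≤ y + 4 * b)
    rw [Complex.sub_im, Complex.ofReal_im, sub_zero] at hzs
    refine ⟨hzs, (zpow_pos two_pos n).trans_le hz.1, ?_⟩
    rw [add_sub_cancel_left, ← h4b]
    exact hz.2
  have hmain := lintegral_laplace_rpow_le hq hb0
    (ENNReal.mul_ne_top hQt ENNReal.ofReal_ne_top) hρM hρre hgm
    (P := 2 * 2 ^ p * (2 * l)) (by positivity) hgP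
  calc ∫⁻ z in dyadicStrip n, ‖laplace f z‖ₑ ^ q ∂μ = ∫⁻ z, ‖laplace g z‖ₑ ^ q ∂ρ := by
        rw [hρ, lintegral_map ((measurable_laplace hgm).enorm.pow_const q) hsubm]
        refine lintegral_congr fun z => ?_
        rw [laplace_eq_laplace_sub f b z]
    _ ≤ _ := hmain
    _ = _ := by
        have hl' := latticeConst_pos
        have hi := interpConst_pos hq
        have hs : 0 ≤ stripConst b := by unfold stripConst; positivity
        rw [h2n, hl, ← ENNReal.ofReal_mul (by positivity),
          ENNReal.ofReal_rpow_of_nonneg (by positivity) hq1.le]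
        have e : embeddingConst q * (2 * b * l) ^ (q - 1) =
            interpConst q * stripConst b * (4 * b) ^ q *
              (2 * 2 ^ p * (2 * l)) ^ (q - 1) := by
          unfold embeddingConst stripConst
          rw [← hp, show 2 * 2 ^ p * (2 * l) = (2 * 2 ^ p) * (2 * l) by ring,
            Real.mul_rpow (x := 2 * 2 ^ p) (by positivity) (by positivity),
            show 2 * b * l = b * (2 * l) by ring,
            Real.mul_rpow (x := b) (by positivity) (by positivity),
            Real.mul_rpow (x := 4) (by positivity) (by positivity),
            show b ^ q = b ^ (q - 1) * b by rw [← Real.rpow_add_one hb0.ne']; ring_nf]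
          field_simp
          ring
        calc _ = ENNReal.ofReal (interpConst q * stripConst b * (4 * b) ^ q *
              (2 * 2 ^ p * (2 * l)) ^ (q - 1)) * Q := by
              rw [ENNReal.ofReal_mul (by positivity), ENNReal.ofReal_mul (by positivity),
                ENNReal.ofReal_mul hi.le]
              ring
          _ = _ := by
              rw [← e, ENNReal.ofReal_mul hC.le]
              ring

theorem univ_subset_union_dyadicStrip :
    (univ : Set ℂ) ⊆ {z : ℂ | z.re ≤ 0} ∪ ⋃ n : ℤ, dyadicStrip n := by
  intro z _
  rcases le_or_gt z.re 0 with h | h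
  · exact Or.inl h
  · obtain ⟨n, hn⟩ := exists_mem_Ico_zpow h one_lt_two
    exact Or.inr (mem_iUnion.2 ⟨n, hn⟩)

/-- for `q ≥ 2`, a Young function `Φ̃` and `Φ(t) = Φ̃(t^{q'})`,
`‖𝓛 : L^Φ(0,∞) → L^q(ℂ₊,μ)‖^q ≲ ∑_{n∈ℤ} (2^n ‖e^{-q'2^{n-1}·}‖_{L^{Φ̃ᶜ}})^{q-1} 𝒞_q[μ_n]`,
with the implied constant depending only on `q`. -/
theorem laplace_carleson_orlicz_sufficiency (q : ℝ) (hq : 2 ≤ q) :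
    ∃ C : ℝ, 0 < C ∧
      ∀ (Φt : ℝ → ℝ), YoungFunction Φt →
        ∀ Φ : ℝ → ℝ, (∀ t : ℝ, 0 ≤ t → Φ t = Φt (t ^ (q / (q - 1)))) →
          ∀ μ : Measure ℂ, μ {z : ℂ | z.re ≤ 0} = 0 →
            lapOrliczOpNorm Φ μ q ^ q ≤ ENNReal.ofReal C *
              ∑' n : ℤ,
                ((2:ℝ≥0∞) ^ n *
                    luxNorm (youngConj Φt) (Ioi 0)
                      (fun t => ((Real.exp (-(q / (q - 1)) * (2:ℝ) ^ (n - 1) * t) : ℝ) : ℂ)))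
                  ^ (q - 1) *
                  carlesonIntensity q (stripPart μ n) := by
  refine ⟨embeddingConst q, embeddingConst_pos hq, fun Φt hΦt Φ hΦ μ hμ => ?_⟩
  have hq0 : 0 < q := by linarith
  rw [← ENNReal.le_rpow_inv_iff hq0]
  refine iSup_le fun f => iSup_le fun hf => iSup_le fun hfΦ => ?_
  have hfΦ' : luxNorm (fun t => Φt (t ^ (q / (q - 1)))) (Ioi 0) f ≤ 1 := by
    refine le_trans (le_of_eq ?_) hfΦ
    refine iInf_congr fun k => iInf_congr fun hk => ?_
    simp only [fun s => hΦ (‖f s‖ / k) (by positivity)]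
  rw [eLpNorm_eq_lintegral_rpow_enorm_toReal (by simpa using hq0) ENNReal.ofReal_ne_top,
    ENNReal.toReal_ofReal hq0.le, one_div]
  gcongr
  calc ∫⁻ z, ‖laplace f z‖ₑ ^ q ∂μ
      = ∫⁻ z in univ, ‖laplace f z‖ₑ ^ q ∂μ := (setLIntegral_univ _).symm
    _ ≤ ∫⁻ z in {z : ℂ | z.re ≤ 0} ∪ ⋃ n : ℤ, dyadicStrip n, ‖laplace f z‖ₑ ^ q ∂μ :=
        lintegral_mono_set univ_subset_union_dyadicStrip
    _ ≤ ∫⁻ z in {z : ℂ | z.re ≤ 0}, ‖laplace f z‖ₑ ^ q ∂μ +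
          ∫⁻ z in ⋃ n : ℤ, dyadicStrip n, ‖laplace f z‖ₑ ^ q ∂μ := lintegral_union_le _ _ _
    _ ≤ 0 + ∑' n : ℤ, ∫⁻ z in dyadicStrip n, ‖laplace f z‖ₑ ^ q ∂μ := by
        gcongr
        · exact (setLIntegral_measure_zero _ _ hμ).le
        · exact lintegral_iUnion_le _ _
    _ ≤ _ := by
        rw [zero_add, ← ENNReal.tsum_mul_left]
        exact ENNReal.tsum_le_tsum fun n => setLIntegral_dyadicStrip_le hq hΦt μ hf hfΦ' n
end
end

section
/- Let q' ≥ 1 and let (γ_n)_{n∈ℤ} be a sequence of reals with γ_n ≥ 1 for all n and γ_n → ∞ as |n| → ∞. Then there exists a Young function Ψ such that ∫₀^∞ Ψ(2^n·e^{−q'·2^{n−1}·t}/γ_n) dt ≤ 1 for all n ∈ ℤ; equivalently, 2^n·‖t ↦ e^{−q'·2^{n−1}·t}‖_{L^Ψ(0,∞)} ≤ γ_n for all n ∈ ℤ. -/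
open MeasureTheory Set Complex Filter
open scoped ENNReal NNReal

noncomputable section

/-- The supremum of the affine functions `k * (t - T k)`, `k ∈ ℕ`. -/
def supAffine (T : ℕ → ℝ) (t : ℝ) : ℝ := ⨆ k : ℕ, (k : ℝ) * (t - T k)

section SupAffine

variable {T : ℕ → ℝ}

lemma supAffine_bddAbove (hT : ∀ k : ℕ, (k : ℝ) ≤ T k) (t : ℝ) :
    BddAbove (range fun k : ℕ => (k : ℝ) * (t - T k)) := by
  refine ⟨t ^ 2, ?_⟩
  rintro _ ⟨k, rfl⟩
  have hk : (0 : ℝ) ≤ k := Nat.cast_nonneg k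
  nlinarith [mul_le_mul_of_nonneg_left (hT k) hk, sq_nonneg (t - k), sq_nonneg t]

lemma le_supAffine (hT : ∀ k : ℕ, (k : ℝ) ≤ T k) (t : ℝ) (k : ℕ) :
    (k : ℝ) * (t - T k) ≤ supAffine T t :=
  le_ciSup (supAffine_bddAbove hT t) k

lemma supAffine_nonneg (hT : ∀ k : ℕ, (k : ℝ) ≤ T k) (t : ℝ) : 0 ≤ supAffine T t := by
  simpa using le_supAffine hT t 0

lemma monotone_supAffine (hT : ∀ k : ℕ, (k : ℝ) ≤ T k) : Monotone (supAffine T) := by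
  intro s t hst
  refine ciSup_le fun k => le_trans ?_ (le_supAffine hT t k)
  gcongr

lemma convexOn_supAffine (hT : ∀ k : ℕ, (k : ℝ) ≤ T k) : ConvexOn ℝ univ (supAffine T) := by
  refine ⟨convex_univ, fun x _ y _ a b ha hb hab => ciSup_le fun k => ?_⟩
  have hx := mul_le_mul_of_nonneg_left (le_supAffine hT x k) ha
  have hy := mul_le_mul_of_nonneg_left (le_supAffine hT y k) hb
  simp only [smul_eq_mul]
  calc (k : ℝ) * (a * x + b * y - T k)
      = a * (k * (x - T k)) + b * (k * (y - T k)) := by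
        rw [eq_sub_of_add_eq hab]; ring
    _ ≤ _ := add_le_add hx hy

lemma supAffine_eq_zero (hT : ∀ k : ℕ, (k : ℝ) ≤ T k) {t : ℝ} (ht : t ≤ 1) :
    supAffine T t = 0 := by
  refine le_antisymm (ciSup_le fun k => ?_) (supAffine_nonneg hT t)
  rcases Nat.eq_zero_or_pos k with rfl | hk
  · simp
  · have h1 : (1 : ℝ) ≤ k := by exact_mod_cast hk
    exact mul_nonpos_of_nonneg_of_nonpos (by positivity) (by linarith [hT k])

lemma youngFunction_supAffine (hT : ∀ k : ℕ, (k : ℝ) ≤ T k) : YoungFunction (supAffine T) := by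
  have hconv := convexOn_supAffine hT
  refine ⟨fun t _ => supAffine_nonneg hT t, (monotone_supAffine hT).monotoneOn _,
    (hconv.continuousOn isOpen_univ).mono (subset_univ _),
    hconv.subset (subset_univ _) (convex_Ici 0), ?_, ?_⟩
  · refine tendsto_const_nhds.congr' ?_
    filter_upwards [nhdsWithin_le_nhds (Iio_mem_nhds (zero_lt_one (α := ℝ)))] with t ht
    rw [supAffine_eq_zero hT (le_of_lt ht), zero_div]
  · refine tendsto_atTop.2 fun B => ?_
    obtain ⟨k, hk⟩ := exists_nat_ge (2 * B)
    filter_upwards [eventually_ge_atTop (2 * T k), eventually_gt_atTop 0] with t ht ht0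
    rw [le_div_iff₀ ht0]
    have hk0 : (0 : ℝ) ≤ k := Nat.cast_nonneg k
    calc B * t ≤ k / 2 * t := by gcongr; linarith
      _ = k * (t - t / 2) := by ring
      _ ≤ k * (t - T k) := by gcongr; linarith
      _ ≤ _ := le_supAffine hT t k

end SupAffine

lemma exists_thresholds {γ : ℤ → ℝ} (hγ : Tendsto γ cofinite atTop) :
    ∃ T : ℕ → ℝ, (∀ k : ℕ, (k : ℝ) ≤ T k) ∧
      ∀ (k : ℕ) (n : ℤ), γ n < 2 * k → (2 : ℝ) ^ n ≤ T k := by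
  have h : ∀ k : ℕ, ∃ M : ℝ, (k : ℝ) ≤ M ∧ ∀ n : ℤ, γ n < 2 * k → (2 : ℝ) ^ n ≤ M := by
    intro k
    have hfin : {n : ℤ | γ n < 2 * k}.Finite := by
      simpa only [not_le] using eventually_cofinite.1 (hγ.eventually_ge_atTop (2 * (k : ℝ)))
    obtain ⟨M, hM⟩ := (hfin.image fun n : ℤ => (2 : ℝ) ^ n).bddAbove
    exact ⟨max k M, le_max_left _ _,
      fun n hn => (hM (mem_image_of_mem _ hn)).trans (le_max_right _ _)⟩
  choose T hT hT' using h
  exact ⟨T, hT, hT'⟩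

/-- On the segment joining `0` to `2 ^ n / γ n`, `supAffine T` is dominated by the linear function
with value `2 ^ (n - 1)` at the right endpoint. -/
lemma supAffine_mul_le {γ : ℤ → ℝ} (hγ1 : ∀ n : ℤ, 1 ≤ γ n) {T : ℕ → ℝ}
    (hT : ∀ k : ℕ, (k : ℝ) ≤ T k) (hγT : ∀ (k : ℕ) (n : ℤ), γ n < 2 * k → (2 : ℝ) ^ n ≤ T k)
    (n : ℤ) {s : ℝ} (hs0 : 0 ≤ s) (hs1 : s ≤ 1) :
    supAffine T (2 ^ n * s / γ n) ≤ 2 ^ (n - 1) * s := by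
  refine ciSup_le fun k => ?_
  have hγ0 : 0 < γ n := zero_lt_one.trans_le (hγ1 n)
  have hk : (0 : ℝ) ≤ k := Nat.cast_nonneg k
  have hpow : (0 : ℝ) < 2 ^ n := by positivity
  rcases lt_or_ge (γ n) (2 * k) with h | h
  · have hle : (2 : ℝ) ^ n * s / γ n ≤ 2 ^ n := by
      rw [div_le_iff₀ hγ0]
      exact mul_le_mul_of_nonneg_left (hs1.trans (hγ1 n)) hpow.le
    exact (mul_nonpos_of_nonneg_of_nonpos hk (by linarith [hγT k n h])).trans (by positivity)
  · calc (k : ℝ) * (2 ^ n * s / γ n - T k) ≤ k * (2 ^ n * s / γ n) := by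
          gcongr; linarith [hT k]
      _ = k * (2 ^ n * s) / γ n := by ring
      _ ≤ 2 ^ (n - 1) * s := by
          rw [div_le_iff₀ hγ0, zpow_sub_one₀ two_ne_zero]
          nlinarith [mul_le_mul_of_nonneg_left h (mul_nonneg hpow.le hs0)]

lemma lintegral_exp_neg_mul_Ioi {a : ℝ} (ha : 0 < a) :
    ∫⁻ t in Ioi (0 : ℝ), ENNReal.ofReal (Real.exp (-a * t)) = ENNReal.ofReal a⁻¹ := by
  rw [← ofReal_integral_eq_lintegral_ofReal (integrableOn_exp_mul_Ioi (neg_lt_zero.2 ha) 0)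
    (ae_of_all _ fun t => (Real.exp_pos _).le), integral_exp_mul_Ioi (neg_lt_zero.2 ha) 0]
  simp

/-- given `q' ≥ 1` and `γ : ℤ → ℝ` with `γ_n ≥ 1` and `γ_n → ∞` as
`|n| → ∞`, there is a Young function `Ψ` with
`∫₀^∞ Ψ(2^n e^{−q'2^{n−1}t}/γ_n) dt ≤ 1`, i.e. `2^n ‖e^{−q'2^{n−1}·}‖_{L^Ψ(0,∞)} ≤ γ_n`,
for all `n ∈ ℤ`. -/
theorem young_function_exists (q' : ℝ) (hq' : 1 ≤ q') (γ : ℤ → ℝ)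
    (hγ1 : ∀ n : ℤ, 1 ≤ γ n) (hγ : Tendsto γ cofinite atTop) :
    ∃ Ψ : ℝ → ℝ, YoungFunction Ψ ∧
      ∀ n : ℤ,
        (∫⁻ t in Ioi (0:ℝ),
          ENNReal.ofReal (Ψ ((2:ℝ) ^ n * Real.exp (-q' * (2:ℝ) ^ (n - 1) * t) / γ n))) ≤ 1 ∧
        (2:ℝ≥0∞) ^ n *
            luxNorm Ψ (Ioi 0)
              (fun t => ((Real.exp (-q' * (2:ℝ) ^ (n - 1) * t) : ℝ) : ℂ)) ≤
          ENNReal.ofReal (γ n) := by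
  obtain ⟨T, hT, hγT⟩ := exists_thresholds hγ
  refine ⟨supAffine T, youngFunction_supAffine hT, fun n => ?_⟩
  have hγ0 : 0 < γ n := zero_lt_one.trans_le (hγ1 n)
  have hpow : (0 : ℝ) < 2 ^ (n - 1) := by positivity
  have hpow' : (0 : ℝ) < 2 ^ n := by positivity
  have ha : 0 < q' * (2 : ℝ) ^ (n - 1) := by positivity
  have hint : (∫⁻ t in Ioi (0:ℝ), ENNReal.ofReal
      (supAffine T ((2:ℝ) ^ n * Real.exp (-q' * (2:ℝ) ^ (n - 1) * t) / γ n))) ≤ 1 := by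
    calc _ ≤ ∫⁻ t in Ioi (0:ℝ), ENNReal.ofReal (2 ^ (n - 1)) *
            ENNReal.ofReal (Real.exp (-(q' * (2:ℝ) ^ (n - 1)) * t)) := by
          refine setLIntegral_mono' measurableSet_Ioi fun t ht => ?_
          rw [← ENNReal.ofReal_mul hpow.le, neg_mul q']
          refine ENNReal.ofReal_le_ofReal
            (supAffine_mul_le hγ1 hT hγT n (Real.exp_pos _).le (Real.exp_le_one_iff.2 ?_))
          nlinarith [mul_pos ha (mem_Ioi.1 ht)]
      _ = ENNReal.ofReal (2 ^ (n - 1) * (q' * 2 ^ (n - 1))⁻¹) := by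
          rw [lintegral_const_mul' _ _ ENNReal.ofReal_ne_top, lintegral_exp_neg_mul_Ioi ha,
            ← ENNReal.ofReal_mul hpow.le]
      _ ≤ 1 := by
          rw [ENNReal.ofReal_le_one, ← div_eq_mul_inv, div_le_one ha]
          exact le_mul_of_one_le_left hpow.le hq'
  refine ⟨hint, ?_⟩
  have hlux : luxNorm (supAffine T) (Ioi 0)
      (fun t => ((Real.exp (-q' * (2:ℝ) ^ (n - 1) * t) : ℝ) : ℂ)) ≤
        ENNReal.ofReal (γ n / 2 ^ n) := by
    refine iInf_le_of_le (γ n / 2 ^ n) (iInf_le_of_le (by positivity) (iInf_le_of_le ?_ le_rfl))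
    convert hint using 5 with t
    rw [Complex.norm_real, Real.norm_of_nonneg (Real.exp_pos _).le]
    field_simp
  have h2 : (2 : ℝ≥0∞) ^ n = ENNReal.ofReal ((2 : ℝ) ^ n) := by
    rw [ENNReal.ofReal, Real.toNNReal_of_nonneg hpow'.le]
    exact (ENNReal.coe_zpow (two_ne_zero (α := ℝ≥0)) n).symm
  calc _ ≤ (2 : ℝ≥0∞) ^ n * ENNReal.ofReal (γ n / 2 ^ n) := by gcongr
    _ = ENNReal.ofReal (γ n) := by
      rw [h2, ← ENNReal.ofReal_mul hpow'.le, mul_div_cancel₀ _ hpow'.ne']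
end
end

section
/- Let μ be a positive Borel measure on ℂ₊, let α > 1, and let Φ_α(t) = exp(t^α) − t^α − 1. Then the Laplace transform 𝓛 : L^{Φ_α}(0,1) → L^2(ℂ₊, μ) is bounded if and only if ∑_{n=1}^∞ n^{2/α}·𝒞_2[μ_n] + sup{μ(Q_I) : I ⊂ iℝ a bounded interval with |I| = 2} < ∞, with an associated equivalence of norms. -/
open MeasureTheory Set Complex Filter
open scoped ENNReal NNReal

noncomputable section

/-- The Young function `Φ_α(t) = exp(t^α) − t^α − 1`. -/
def PhiAlpha (α : ℝ) (t : ℝ) : ℝ := Real.exp (t ^ α) - t ^ α - 1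

/-- The operator norm of `𝓛 : L^Φ(0,1) → L²(ℂ₊,μ)`. -/
def lapOrliczOpNormOn (Φ : ℝ → ℝ) (μ : Measure ℂ) : ℝ≥0∞ :=
  ⨆ (f : ℝ → ℂ) (_ : Measurable f) (_ : luxNorm Φ (Ioo 0 1) f ≤ 1),
    eLpNorm (laplaceOn 1 f) 2 μ

theorem ENNReal.tsum_mul_sq_le {ι : Type*} (p b : ι → ℝ≥0∞) :
    (∑' j, p j * b j) ^ 2 ≤ (∑' j, p j) * ∑' j, p j * b j ^ 2 := by
  let _ : MeasurableSpace ι := ⊤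
  have hsq : ∀ x : ℝ≥0∞, (x ^ (1 / 2 : ℝ)) ^ 2 = x := fun x => by
    rw [← ENNReal.rpow_natCast, ← ENNReal.rpow_mul]; norm_num
  have h := ENNReal.lintegral_mul_le_Lp_mul_Lq (α := ι) Measure.count Real.HolderConjugate.two_two
    (f := fun j => p j ^ (1 / 2 : ℝ)) (g := fun j => p j ^ (1 / 2 : ℝ) * b j)
    (measurable_from_top).aemeasurable (measurable_from_top).aemeasurable
  simp only [Pi.mul_apply, lintegral_count, ← mul_assoc, ← sq, hsq, ENNReal.rpow_two, mul_pow] at h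
  calc _ ≤ _ := pow_le_pow_left' h 2
    _ = _ := by rw [mul_pow, hsq, hsq]

theorem eLpNorm_two_pow_two {X : Type*} [MeasurableSpace X] (f : X → ℂ) (μ : Measure X) :
    eLpNorm f 2 μ ^ 2 = ∫⁻ x, ‖f x‖ₑ ^ 2 ∂μ := by
  simpa using eLpNorm_nnreal_pow_eq_lintegral (f := f) (μ := μ) (p := 2) two_ne_zero

theorem tsum_enorm_fourierCoeffOn_sq {a b : ℝ} (hab : a < b) {f : ℝ → ℂ}
    (hf : MemLp f 2 (volume.restrict (Ioc a b))) :
    ∑' k : ℤ, ‖fourierCoeffOn hab f k‖ₑ ^ 2 =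
      ENNReal.ofReal (b - a)⁻¹ * ∫⁻ t in Ioc a b, ‖f t‖ₑ ^ 2 := by
  have h := hasSum_sq_fourierCoeffOn hab hf
  have hpos : 0 ≤ (b - a)⁻¹ := inv_nonneg.2 (sub_nonneg.2 hab.le)
  have e : ∀ k : ℤ, ‖fourierCoeffOn hab f k‖ₑ ^ 2 =
      ENNReal.ofReal (‖fourierCoeffOn hab f k‖ ^ 2) := fun k => by
    rw [ENNReal.ofReal_pow (norm_nonneg _), ofReal_norm]
  simp_rw [e]
  rw [← ENNReal.ofReal_tsum_of_nonneg (fun _ => by positivity) h.summable, h.tsum_eq, smul_eq_mul,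
    ENNReal.ofReal_mul hpos, intervalIntegral.integral_of_le hab.le,
    ofReal_integral_eq_lintegral_ofReal (hf.integrable_norm_pow two_ne_zero)
      (Eventually.of_forall fun _ => by positivity)]
  congr 1
  refine lintegral_congr fun t => ?_
  rw [ENNReal.ofReal_pow (norm_nonneg _), ofReal_norm]

/-- A Bessel-type inequality for values of the Laplace transform of a function on `(a, b]`
near the lattice points `2πik/(b-a)`. -/
theorem exists_laplace_majorant {a b : ℝ} (hab : a < b) {g : ℝ → ℂ}
    (hg : MemLp g 2 (volume.restrict (Ioc a b))) {R : ℝ} (hR : 0 ≤ R) :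
    ∃ D : ℤ → ℝ≥0∞,
      (∀ (k : ℤ) (z : ℂ), ‖z - 2 * Real.pi * Complex.I * k / ((b - a : ℝ) : ℂ)‖ * (b - a) ≤ R →
        ‖∫ t in a..b, Complex.exp (-z * t) * g t‖ₑ ^ 2 ≤
          ENNReal.ofReal (Real.exp (-z.re * a)) ^ 2 * D k) ∧
      ∑' k, D k ≤ ENNReal.ofReal (Real.exp R ^ 2 * (b - a)) * ∫⁻ t in Ioc a b, ‖g t‖ₑ ^ 2 := by
  have hℓ : 0 < b - a := sub_pos.2 hab
  set ℓ := b - a with hℓdef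
  have hℓc : (ℓ : ℂ) ≠ 0 := by exact_mod_cast hℓ.ne'
  let h : ℕ → ℝ → ℂ := fun j t => (((t - a) / ℓ : ℝ) : ℂ) ^ j * g t
  have hbd : ∀ t ∈ Ioc a b, ‖(((t - a) / ℓ : ℝ) : ℂ)‖ ≤ 1 := fun t ht => by
    rw [Complex.norm_real, Real.norm_eq_abs, abs_of_nonneg (div_nonneg (by linarith [ht.1]) hℓ.le)]
    rw [div_le_one hℓ]; linarith [ht.2]
  have hjle : ∀ j, ∀ t ∈ Ioc a b, ‖h j t‖ ≤ ‖g t‖ := fun j t ht => by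
    simp only [h, norm_mul, norm_pow]
    exact mul_le_of_le_one_left (norm_nonneg _) (pow_le_one₀ (norm_nonneg _) (hbd t ht))
  have hjmeas : ∀ j, AEStronglyMeasurable (h j) (volume.restrict (Ioc a b)) := fun j =>
    AEStronglyMeasurable.mul (by fun_prop) hg.1
  have hjL : ∀ j, MemLp (h j) 2 (volume.restrict (Ioc a b)) := fun j =>
    hg.mono (hjmeas j) ((ae_restrict_iff' measurableSet_Ioc).2 (Eventually.of_forall (hjle j)))
  have hgint : IntegrableOn g (Ioc a b) := hg.integrable one_le_two
  let p : ℕ → ℝ≥0∞ := fun j => ENNReal.ofReal (R ^ j / (Nat.factorial j : ℝ))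
  have hexpR : HasSum (fun j : ℕ => R ^ j / (Nat.factorial j : ℝ)) (Real.exp R) := by
    rw [Real.exp_eq_exp_ℝ]; exact NormedSpace.expSeries_div_hasSum_exp R
  have hp : ∑' j, p j = ENNReal.ofReal (Real.exp R) := by
    rw [← ENNReal.ofReal_tsum_of_nonneg (fun _ => by positivity) hexpR.summable, hexpR.tsum_eq]
  let c : ℕ → ℤ → ℂ := fun j k => ℓ * fourierCoeffOn hab (h j) k
  have hc : ∀ j k, c j k = ∫ t in a..b,
      Complex.exp (-(2 * Real.pi * Complex.I * k / ℓ) * t) * h j t := fun j k => by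
    simp only [c]
    rw [fourierCoeffOn_eq_integral, Complex.real_smul, ← mul_assoc]
    push_cast
    rw [← Complex.ofReal_sub, ← hℓdef, mul_one_div_cancel hℓc, one_mul]
    refine intervalIntegral.integral_congr fun t _ => ?_
    simp only [fourier_coe_apply, smul_eq_mul]
    congr 2
    push_cast
    rw [hℓdef]
    push_cast
    ring
  refine ⟨fun k => ENNReal.ofReal (Real.exp R) * ∑' j, p j * ‖c j k‖ₑ ^ 2, ?_, ?_⟩
  · intro k z hz
    set θ : ℂ := 2 * Real.pi * Complex.I * k / ℓ with hθ
    have hθre : θ.re = 0 := by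
      have : θ = ((2 * Real.pi * k / ℓ : ℝ) : ℂ) * Complex.I := by
        rw [hθ]; push_cast; ring
      rw [this, Complex.re_ofReal_mul]; simp
    set w := z - θ with hw
    have hcθ : ∀ j, c j k = ∫ t in a..b, Complex.exp (-θ * t) * h j t := fun j => hc j k
    have hsum : HasSum (fun j : ℕ => (-(w * ℓ)) ^ j / (Nat.factorial j : ℂ) * c j k)
        (∫ t in a..b, Complex.exp (-θ * t) * (Complex.exp (-w * (t - a)) * g t)) := by
      have := intervalIntegral.hasSum_integral_of_dominated_convergence (a := a) (b := b)
        (μ := volume) (ι := ℕ)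
        (F := fun j t => (-(w * ℓ)) ^ j / (Nat.factorial j : ℂ) *
          (Complex.exp (-θ * t) * h j t))
        (f := fun t => Complex.exp (-θ * t) * (Complex.exp (-w * (t - a)) * g t))
        (fun j t => R ^ j / (Nat.factorial j : ℝ) * ‖g t‖) ?_ ?_ ?_ ?_ ?_
      · simpa only [intervalIntegral.integral_const_mul, ← hcθ] using this
      · intro j
        rw [uIoc_of_le hab.le]
        exact (AEStronglyMeasurable.mul (by fun_prop) (hjmeas j)).const_mul _
      · intro j
        rw [uIoc_of_le hab.le]
        refine Eventually.of_forall fun t ht => ?_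
        rw [norm_mul, norm_mul, norm_div, norm_pow, norm_neg, norm_mul, Complex.norm_real,
          Real.norm_eq_abs, abs_of_pos hℓ, Complex.norm_natCast, Complex.norm_exp]
        have : (-θ * (t : ℂ)).re = 0 := by simp [hθre]
        rw [this, Real.exp_zero, one_mul]
        gcongr
        exact hjle j t ht
      · exact Eventually.of_forall fun t _ => hexpR.summable.mul_right _
      · simp only [tsum_mul_right]
        rw [intervalIntegrable_iff, uIoc_of_le hab.le]
        exact hgint.norm.const_mul _
      · rw [uIoc_of_le hab.le]
        refine Eventually.of_forall fun t ht => ?_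
        have h1 : HasSum (fun j : ℕ => (-w * (t - a)) ^ j / (Nat.factorial j : ℂ))
            (Complex.exp (-w * (t - a))) := by
          rw [Complex.exp_eq_exp_ℂ]; exact NormedSpace.expSeries_div_hasSum_exp _
        rw [← mul_assoc]
        refine ((h1.mul_left (Complex.exp (-θ * t))).mul_right (g t)).congr_fun fun j => ?_
        · simp only [h]
          have : -w * ((t : ℂ) - a) = (-(w * ℓ)) * (((t - a) / ℓ : ℝ) : ℂ) := by
            push_cast; field_simp
          rw [this, mul_pow]; ring
    have hfac : ∫ t in a..b, Complex.exp (-z * t) * g t = Complex.exp (-w * a) *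
        ∫ t in a..b, Complex.exp (-θ * t) * (Complex.exp (-w * (t - a)) * g t) := by
      rw [← intervalIntegral.integral_const_mul]
      refine intervalIntegral.integral_congr fun t _ => ?_
      simp only [← mul_assoc, ← Complex.exp_add]
      congr 2
      rw [hw]; ring
    have hnorm : ‖Complex.exp (-w * a)‖ₑ = ENNReal.ofReal (Real.exp (-z.re * a)) := by
      rw [← ofReal_norm, Complex.norm_exp]
      congr 2
      simp [hw, hθre]
    rw [hfac, enorm_mul, mul_pow, hnorm]
    gcongr
    rw [← hsum.tsum_eq, ← hp]
    refine le_trans (pow_le_pow_left' (enorm_tsum_le_tsum_enorm.trans ?_) 2)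
      (ENNReal.tsum_mul_sq_le p fun j => ‖c j k‖ₑ)
    refine ENNReal.tsum_le_tsum fun j => ?_
    rw [enorm_mul]
    gcongr
    rw [← ofReal_norm]
    refine ENNReal.ofReal_le_ofReal ?_
    rw [norm_div, norm_pow, norm_neg, norm_mul, Complex.norm_real, Real.norm_eq_abs,
      abs_of_pos hℓ, Complex.norm_natCast]
    gcongr
  · rw [ENNReal.tsum_mul_left, ENNReal.tsum_comm]
    simp_rw [ENNReal.tsum_mul_left]
    have key : ∀ j, ∑' k, ‖c j k‖ₑ ^ 2 ≤ ENNReal.ofReal ℓ * ∫⁻ t in Ioc a b, ‖g t‖ₑ ^ 2 := by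
      intro j
      simp only [c, enorm_mul, mul_pow]
      rw [ENNReal.tsum_mul_left, tsum_enorm_fourierCoeffOn_sq hab (hjL j), ← mul_assoc]
      have : ‖(ℓ : ℂ)‖ₑ ^ 2 * ENNReal.ofReal (b - a)⁻¹ = ENNReal.ofReal ℓ := by
        rw [← ofReal_norm, ← ENNReal.ofReal_pow (norm_nonneg _),
          ← ENNReal.ofReal_mul (by positivity), Complex.norm_real, Real.norm_eq_abs, abs_of_pos hℓ,
          ← hℓdef]
        congr 1; field_simp
      rw [this]
      refine mul_le_mul_right ?_ _
      refine setLIntegral_mono' measurableSet_Ioc fun t ht => ?_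
      gcongr 1
      exact enorm_le_iff_norm_le.2 (hjle j t ht)
    calc _ ≤ ENNReal.ofReal (Real.exp R) * ∑' j, p j *
          (ENNReal.ofReal ℓ * ∫⁻ t in Ioc a b, ‖g t‖ₑ ^ 2) := by
          gcongr with j; exact key j
      _ = _ := by
        rw [ENNReal.tsum_mul_right, hp, ENNReal.ofReal_mul (by positivity),
          ENNReal.ofReal_pow (by positivity)]
        ring

theorem sum_range_inv_two_pow_le (N : ℕ) : ∑ j ∈ Finset.range N, (2⁻¹ : ℝ≥0∞) ^ j ≤ 2 := by
  refine (ENNReal.sum_le_tsum _).trans ?_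
  rw [ENNReal.tsum_geometric, ENNReal.one_sub_inv_two, inv_inv]

theorem exp_neg_nat_le (j : ℕ) : Real.exp (-(j : ℝ)) ≤ 2⁻¹ ^ j := by
  have h : Real.exp (-1) ≤ 2⁻¹ := by
    rw [Real.exp_neg]
    gcongr
    linarith [Real.add_one_le_exp 1]
  calc Real.exp (-(j : ℝ)) = Real.exp (-1) ^ j := by rw [← Real.exp_nat_mul]; ring_nf
    _ ≤ _ := by gcongr

theorem laplaceOn_one_eq_intervalIntegral (f : ℝ → ℂ) (z : ℂ) {T : ℝ} (hT : 1 ≤ T) :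
    laplaceOn 1 f z = ∫ t in (0 : ℝ)..T, Complex.exp (-z * t) * (Ioo (0 : ℝ) 1).indicator f t := by
  rw [intervalIntegral.integral_of_le (by linarith), laplaceOn,
    ← integral_indicator measurableSet_Ioo, ← integral_indicator measurableSet_Ioc]
  refine integral_congr_ae (Eventually.of_forall fun t => ?_)
  by_cases ht : t ∈ Ioo (0 : ℝ) 1
  · have ht' : t ∈ Ioc (0 : ℝ) T := ⟨ht.1, ht.2.le.trans hT⟩
    simp [ht, ht']
  · simp [indicator_of_notMem ht, indicator_apply (Ioc 0 T)]

/-- Majorants of the Laplace transform on the boxes `|Im z - 2Nk| ≤ N`, in terms of the local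
`L²` norms of `f` on intervals of length `π / N`. -/
theorem exists_laplaceOn_majorant {f : ℝ → ℂ} (hf : MemLp f 2 (volume.restrict (Ioo 0 1)))
    {N : ℕ} (hN : 1 ≤ N) :
    ∃ D : ℤ → ℝ≥0∞,
      (∀ (k : ℤ) (z : ℂ), 0 < z.re → z.re ≤ 2 * N → (∀ j < N, (j : ℝ) ≤ z.re * (j / N)) →
        |z.im - 2 * N * k| ≤ N → ‖laplaceOn 1 f z‖ₑ ^ 2 ≤ D k) ∧
      ∑' k, D k ≤ 2 * ∑ j ∈ Finset.range N, (2⁻¹ : ℝ≥0∞) ^ j *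
        (ENNReal.ofReal (Real.exp (3 * Real.pi) ^ 2 * (Real.pi / N)) *
          ∫⁻ t in Ioc (j * (Real.pi / N)) (((j + 1 : ℕ) : ℝ) * (Real.pi / N)),
            ‖(Ioo (0 : ℝ) 1).indicator f t‖ₑ ^ 2) := by
  have hN0 : (0 : ℝ) < N := by exact_mod_cast hN
  have hℓ : 0 < Real.pi / N := by positivity
  set g := (Ioo (0 : ℝ) 1).indicator f with hg
  have hgL : MemLp g 2 volume := (memLp_indicator_iff_restrict measurableSet_Ioo).2 hf
  let a : ℕ → ℝ := fun j => j * (Real.pi / N)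
  have haa : ∀ j, a (j + 1) - a j = Real.pi / N := fun j => by simp only [a]; push_cast; ring
  have hlt : ∀ j, a j < a (j + 1) := fun j => by linarith [haa j]
  choose E hE hEsum using fun j => exists_laplace_majorant (hlt j) (hgL.restrict _)
    (R := 3 * Real.pi) (by positivity)
  refine ⟨fun k => 2 * ∑ j ∈ Finset.range N, (2⁻¹ : ℝ≥0∞) ^ j * E j k, ?_, ?_⟩
  · intro k z hz0 hz hdec him
    have hpiece : ∀ j < N, ‖∫ t in a j..a (j + 1), Complex.exp (-z * t) * g t‖ₑ ^ 2 ≤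
        ((2⁻¹ : ℝ≥0∞) ^ j) ^ 2 * E j k := by
      intro j hj
      refine (hE j k z ?_).trans ?_
      · rw [haa]
        have e : 2 * Real.pi * Complex.I * k / ((Real.pi / N : ℝ) : ℂ) =
            ((2 * N * k : ℝ) : ℂ) * Complex.I := by
          have : (Real.pi : ℂ) ≠ 0 := by exact_mod_cast Real.pi_ne_zero
          have : (N : ℂ) ≠ 0 := by exact_mod_cast hN0.ne'
          push_cast; field_simp
        rw [e]
        have h3 : ‖z - ((2 * N * k : ℝ) : ℂ) * Complex.I‖ ≤ 3 * N := by
          refine (Complex.norm_le_abs_re_add_abs_im _).trans ?_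
          have h1 : (z - ((2 * N * k : ℝ) : ℂ) * Complex.I).re = z.re := by
            rw [Complex.sub_re, Complex.re_ofReal_mul]; simp
          have h2 : (z - ((2 * N * k : ℝ) : ℂ) * Complex.I).im = z.im - 2 * N * k := by
            rw [Complex.sub_im, Complex.im_ofReal_mul]; simp
          rw [h1, h2, abs_of_pos hz0]
          linarith
        calc _ ≤ 3 * N * (Real.pi / N) := by gcongr
          _ = 3 * Real.pi := by field_simp
      · gcongr
        rw [show (2⁻¹ : ℝ≥0∞) ^ j = ENNReal.ofReal (2⁻¹ ^ j) by
          rw [ENNReal.ofReal_pow (by norm_num), ENNReal.ofReal_inv_of_pos two_pos]; simp]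
        refine ENNReal.ofReal_le_ofReal ((Real.exp_le_exp.2 ?_).trans (exp_neg_nat_le j))
        have h1 := hdec j hj
        have h2 : z.re * (j / N) * 1 ≤ z.re * (j / N) * Real.pi := by
          gcongr; linarith [Real.two_le_pi]
        have h3 : -z.re * a j = -(z.re * (j / N) * Real.pi) := by simp only [a]; ring
        rw [h3]; linarith
    have hint : ∀ j < N, IntervalIntegrable (fun t : ℝ => Complex.exp (-z * t) * g t)
        volume (a j) (a (j + 1)) := fun j _ =>
      ((hgL.locallyIntegrable one_le_two).integrableOn_isCompact
        isCompact_uIcc).intervalIntegrable.continuousOn_mul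
        (g := fun t : ℝ => Complex.exp (-z * t)) (Continuous.continuousOn (by fun_prop))
    have hsplit : laplaceOn 1 f z =
        ∑ j ∈ Finset.range N, ∫ t in a j..a (j + 1), Complex.exp (-z * t) * g t := by
      rw [intervalIntegral.sum_integral_adjacent_intervals hint,
        laplaceOn_one_eq_intervalIntegral f z (T := Real.pi) (by linarith [Real.two_le_pi])]
      congr 1
      · simp [a]
      · simp only [a]; field_simp
    have h2 : ∀ j, (2⁻¹ : ℝ≥0∞) ^ j * 2 ^ j = 1 := fun j => by
      rw [← mul_pow, ENNReal.inv_mul_cancel two_ne_zero ENNReal.ofNat_ne_top, one_pow]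
    rw [hsplit]
    have hcs := ENNReal.tsum_mul_sq_le (ι := Fin N) (fun j => (2⁻¹ : ℝ≥0∞) ^ (j : ℕ))
      (fun j => 2 ^ (j : ℕ) * ‖∫ t in a j..a (j + 1), Complex.exp (-z * t) * g t‖ₑ)
    simp only [tsum_fintype, ← mul_assoc, h2, one_mul] at hcs
    rw [← Finset.sum_range (fun j : ℕ => ‖∫ t in a j..a (j + 1), Complex.exp (-z * t) * g t‖ₑ),
      ← Finset.sum_range (fun j : ℕ => (2⁻¹ : ℝ≥0∞) ^ j),
      ← Finset.sum_range (fun j : ℕ => (2⁻¹ : ℝ≥0∞) ^ j *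
        (2 ^ j * ‖∫ t in a j..a (j + 1), Complex.exp (-z * t) * g t‖ₑ) ^ 2)] at hcs
    refine (pow_le_pow_left' (enorm_sum_le _ _) 2).trans (hcs.trans ?_)
    refine mul_le_mul' (sum_range_inv_two_pow_le N) (Finset.sum_le_sum fun j hj => ?_)
    gcongr
    rw [mul_pow]
    calc _ ≤ (2 ^ j) ^ 2 * (((2⁻¹ : ℝ≥0∞) ^ j) ^ 2 * E j k) := by
          gcongr; exact hpiece j (Finset.mem_range.1 hj)
      _ = _ := by rw [← mul_assoc, ← mul_pow, mul_comm (2 ^ j), h2, one_pow, one_mul]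
  · rw [ENNReal.tsum_mul_left]
    gcongr
    rw [Summable.tsum_finsetSum fun _ _ => ENNReal.summable]
    refine Finset.sum_le_sum fun j _ => ?_
    rw [ENNReal.tsum_mul_left]
    gcongr
    refine (hEsum j).trans ?_
    rw [haa]

theorem PhiAlpha_nonneg (α t : ℝ) : 0 ≤ PhiAlpha α t := by
  unfold PhiAlpha; linarith [Real.add_one_le_exp (t ^ α)]

theorem sq_le_rpow_add_PhiAlpha {α : ℝ} (hα : 1 < α) {n N : ℕ} (hn : 1 ≤ n) (hN : 1 ≤ N)
    (hNn : N ≤ 2 ^ n) {u : ℝ} (hu : 0 ≤ u) :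
    u ^ 2 ≤ (4 * n : ℝ) ^ (2 / α) + 16 / N * PhiAlpha α u := by
  have hN0 : (0 : ℝ) < N := by exact_mod_cast hN
  have hn1 : (1 : ℝ) ≤ n := by exact_mod_cast hn
  have hΦ := PhiAlpha_nonneg α u
  set s := u ^ α with hs
  have hs0 : 0 ≤ s := by positivity
  have hus : u ^ 2 = s ^ (2 / α) := by
    rw [hs, ← Real.rpow_mul hu, mul_div_cancel₀ _ (by linarith), Real.rpow_two]
  rw [hus]
  rcases le_total s (4 * n) with h | h
  · have : s ^ (2 / α) ≤ (4 * n : ℝ) ^ (2 / α) := by gcongr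
    have : 0 ≤ 16 / N * PhiAlpha α u := by positivity
    linarith
  · have hs4 : 4 ≤ s := by linarith
    have h1 : s ^ (2 / α) ≤ s ^ 2 := by
      rw [← Real.rpow_two]
      refine Real.rpow_le_rpow_of_exponent_le (by linarith) ?_
      rw [div_le_iff₀ (by linarith)]; linarith
    have h2 : s ^ 2 ≤ 8 * Real.exp (s / 2) := by
      have := Real.quadratic_le_exp_of_nonneg (x := s / 2) (by positivity)
      nlinarith
    have h3 : Real.exp s ≤ 2 * PhiAlpha α u := by
      have := Real.quadratic_le_exp_of_nonneg hs0
      unfold PhiAlpha; rw [← hs]; nlinarith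
    have h4 : N * Real.exp (s / 2) ≤ Real.exp s := by
      have h5 : (N : ℝ) ≤ Real.exp (s / 2) := by
        calc (N : ℝ) ≤ 2 ^ n := by exact_mod_cast hNn
          _ ≤ Real.exp 1 ^ n := by gcongr; linarith [Real.add_one_le_exp 1]
          _ = Real.exp n := by rw [← Real.exp_nat_mul, mul_one]
          _ ≤ _ := Real.exp_le_exp.2 (by linarith)
      calc N * Real.exp (s / 2) ≤ Real.exp (s / 2) * Real.exp (s / 2) := by gcongr
        _ = _ := by rw [← Real.exp_add]; ring_nf
    have h6 : s ^ 2 ≤ 16 / N * PhiAlpha α u := by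
      rw [div_mul_eq_mul_div, le_div_iff₀ hN0]; nlinarith
    have : 0 ≤ (4 * n : ℝ) ^ (2 / α) := by positivity
    linarith

theorem enorm_sq_le_add_PhiAlpha {α : ℝ} (hα : 1 < α) {n N : ℕ} (hn : 1 ≤ n) (hN : 1 ≤ N)
    (hNn : N ≤ 2 ^ n) (w : ℂ) :
    ‖w‖ₑ ^ 2 ≤ ENNReal.ofReal ((4 * n : ℝ) ^ (2 / α)) +
      ENNReal.ofReal (16 / N) * ENNReal.ofReal (PhiAlpha α ‖w‖) := by
  rw [← ENNReal.ofReal_mul (by positivity), ← ENNReal.ofReal_add (by positivity)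
    (mul_nonneg (by positivity) (PhiAlpha_nonneg _ _)), ← ofReal_norm,
    ← ENNReal.ofReal_pow (norm_nonneg _)]
  exact ENNReal.ofReal_le_ofReal (sq_le_rpow_add_PhiAlpha hα hn hN hNn (norm_nonneg w))

theorem memLp_two_of_lintegral_PhiAlpha_le {α : ℝ} (hα : 1 < α) {f : ℝ → ℂ} (hfm : Measurable f)
    (hf : ∫⁻ t in Ioo (0 : ℝ) 1, ENNReal.ofReal (PhiAlpha α ‖f t‖) ≤ 1) :
    MemLp f 2 (volume.restrict (Ioo 0 1)) := by
  refine ⟨hfm.aestronglyMeasurable, ?_⟩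
  have h : eLpNorm f 2 (volume.restrict (Ioo (0 : ℝ) 1)) ^ 2 < ⊤ := by
    rw [eLpNorm_two_pow_two]
    refine lt_of_le_of_lt (lintegral_mono fun t =>
      enorm_sq_le_add_PhiAlpha hα le_rfl le_rfl (by norm_num) (f t)) ?_
    rw [lintegral_add_left measurable_const, lintegral_const_mul' _ _ ENNReal.ofReal_ne_top]
    refine ENNReal.add_lt_top.2 ⟨?_, ENNReal.mul_lt_top ENNReal.ofReal_lt_top
      (hf.trans_lt ENNReal.one_lt_top)⟩
    simp
  exact lt_of_not_ge fun h' => by simp [top_le_iff.1 h'] at h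

/-- The constant in the upper bound. -/
def majorantConst : ℝ := 64 * Real.exp (3 * Real.pi) ^ 2 * Real.pi * (Real.pi + 1)

theorem majorantConst_pos : 0 < majorantConst := by
  unfold majorantConst; positivity

theorem exists_laplaceOn_majorant_of_PhiAlpha {α : ℝ} (hα : 1 < α) {f : ℝ → ℂ}
    (hfm : Measurable f)
    (hf : ∫⁻ t in Ioo (0 : ℝ) 1, ENNReal.ofReal (PhiAlpha α ‖f t‖) ≤ 1)
    {n N : ℕ} (hn : 1 ≤ n) (hN : 1 ≤ N) (hNn : N ≤ 2 ^ n) :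
    ∃ D : ℤ → ℝ≥0∞,
      (∀ (k : ℤ) (z : ℂ), 0 < z.re → z.re ≤ 2 * N → (∀ j < N, (j : ℝ) ≤ z.re * (j / N)) →
        |z.im - 2 * N * k| ≤ N → ‖laplaceOn 1 f z‖ₑ ^ 2 ≤ D k) ∧
      ∑' k, D k ≤ ENNReal.ofReal (majorantConst * (n : ℝ) ^ (2 / α) / N ^ 2) := by
  obtain ⟨D, hD, hDsum⟩ :=
    exists_laplaceOn_majorant (memLp_two_of_lintegral_PhiAlpha_le hα hfm hf) hN
  refine ⟨D, hD, hDsum.trans ?_⟩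
  have hN0 : (0 : ℝ) < N := by exact_mod_cast hN
  have hn1 : (1 : ℝ) ≤ n := by exact_mod_cast hn
  have hpiece : ∀ j : ℕ, ∫⁻ t in Ioc (j * (Real.pi / N)) (((j + 1 : ℕ) : ℝ) * (Real.pi / N)),
      ‖(Ioo (0 : ℝ) 1).indicator f t‖ₑ ^ 2 ≤
        ENNReal.ofReal (16 * (n : ℝ) ^ (2 / α) * (Real.pi + 1) / N) := by
    intro j
    have hP : (4 * n : ℝ) ^ (2 / α) ≤ 16 * (n : ℝ) ^ (2 / α) := by
      rw [Real.mul_rpow (by norm_num) (by positivity)]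
      gcongr
      calc (4 : ℝ) ^ (2 / α) ≤ 4 ^ (2 : ℝ) := by
            refine Real.rpow_le_rpow_of_exponent_le (by norm_num) ?_
            rw [div_le_iff₀ (by linarith)]; linarith
        _ = 16 := by norm_num
    have hn2 : 1 ≤ (n : ℝ) ^ (2 / α) := Real.one_le_rpow hn1 (by positivity)
    calc _ ≤ ∫⁻ t in Ioc (j * (Real.pi / N)) (((j + 1 : ℕ) : ℝ) * (Real.pi / N)),
          (ENNReal.ofReal ((4 * n : ℝ) ^ (2 / α)) + ENNReal.ofReal (16 / N) *
            (Ioo (0 : ℝ) 1).indicator (fun t => ENNReal.ofReal (PhiAlpha α ‖f t‖)) t) := by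
          refine lintegral_mono fun t => ?_
          by_cases ht : t ∈ Ioo (0 : ℝ) 1
          · simp only [indicator_of_mem ht]
            exact enorm_sq_le_add_PhiAlpha hα hn hN hNn (f t)
          · simp [indicator_of_notMem ht]
      _ ≤ ENNReal.ofReal ((4 * n : ℝ) ^ (2 / α)) * ENNReal.ofReal (Real.pi / N) +
            ENNReal.ofReal (16 / N) * 1 := by
          rw [lintegral_add_left measurable_const, lintegral_const_mul' _ _ ENNReal.ofReal_ne_top]
          refine add_le_add (le_of_eq ?_) (mul_le_mul_right ?_ _)
          · rw [setLIntegral_const, Real.volume_Ioc]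
            congr 2; push_cast; ring
          · refine (setLIntegral_le_lintegral _ _).trans ?_
            rwa [lintegral_indicator measurableSet_Ioo]
      _ = ENNReal.ofReal ((4 * n : ℝ) ^ (2 / α) * (Real.pi / N) + 16 / N) := by
          rw [mul_one, ← ENNReal.ofReal_mul (by positivity),
            ← ENNReal.ofReal_add (by positivity) (by positivity)]
      _ ≤ _ := by
          refine ENNReal.ofReal_le_ofReal ?_
          calc _ ≤ 16 * (n : ℝ) ^ (2 / α) * (Real.pi / N) + 16 * (n : ℝ) ^ (2 / α) / N := by
                gcongr; linarith
            _ = _ := by ring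
  calc _ ≤ 2 * ∑ j ∈ Finset.range N, (2⁻¹ : ℝ≥0∞) ^ j *
        (ENNReal.ofReal (Real.exp (3 * Real.pi) ^ 2 * (Real.pi / N)) *
          ENNReal.ofReal (16 * (n : ℝ) ^ (2 / α) * (Real.pi + 1) / N)) := by
        gcongr with j; exact hpiece j
    _ ≤ 2 * (2 * (ENNReal.ofReal (Real.exp (3 * Real.pi) ^ 2 * (Real.pi / N)) *
          ENNReal.ofReal (16 * (n : ℝ) ^ (2 / α) * (Real.pi + 1) / N))) := by
        rw [← Finset.sum_mul]; gcongr; exact sum_range_inv_two_pow_le N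
    _ = _ := by
        rw [← ENNReal.ofReal_mul (by positivity), ← ENNReal.ofReal_ofNat 2,
          ← ENNReal.ofReal_mul (by positivity), ← ENNReal.ofReal_mul (by positivity)]
        congr 1
        unfold majorantConst
        field_simp
        ring

/-- The quantity characterising boundedness of `𝓛 : L^{Φ_α}(0,1) → L²(ℂ₊, μ)`. -/
def carlesonSum (α : ℝ) (μ : Measure ℂ) : ℝ≥0∞ :=
  (∑' n : ℕ, ((n : ℝ≥0∞) + 1) ^ (2 / α) *
    carlesonIntensity 2 (stripPart μ ((n : ℤ) + 1))) + ⨆ a : ℝ, μ (carlesonSquare a (a + 2))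

theorem measurableSet_carlesonSquare (a b : ℝ) : MeasurableSet (carlesonSquare a b) :=
  (Complex.measurable_im measurableSet_Icc).inter (Complex.measurable_re measurableSet_Ioo)

theorem stripPart_le_carlesonIntensity (μ : Measure ℂ) (n : ℤ) {a b : ℝ} (hab : a < b) :
    stripPart μ n (carlesonSquare a b) ≤
      carlesonIntensity 2 (stripPart μ n) * ENNReal.ofReal ((b - a) ^ 2) := by
  have hpos : 0 < (b - a) ^ 2 := by have := sub_pos.2 hab; positivity
  have h : stripPart μ n (carlesonSquare a b) / ENNReal.ofReal ((b - a) ^ (2 : ℝ)) ≤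
      carlesonIntensity 2 (stripPart μ n) :=
    le_iSup_of_le a (le_iSup_of_le b (le_iSup_of_le hab le_rfl))
  rw [Real.rpow_two] at h
  exact (ENNReal.div_le_iff (ENNReal.ofReal_pos.2 hpos).ne' ENNReal.ofReal_ne_top).1 h

theorem exists_int_abs_sub_le {N : ℝ} (hN : 0 < N) (y : ℝ) : ∃ k : ℤ, |y - 2 * N * k| ≤ N := by
  refine ⟨round (y / (2 * N)), ?_⟩
  have h := abs_sub_round (y / (2 * N))
  have e : y - 2 * N * (round (y / (2 * N)) : ℤ) =
      2 * N * (y / (2 * N) - (round (y / (2 * N)) : ℤ)) := by field_simp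
  rw [e, abs_mul, abs_of_pos (by positivity)]
  nlinarith

/-- Integration of a function with box-wise majorants against a measure with uniformly bounded
mass on boxes. -/
theorem setLIntegral_le_mul_tsum_of_majorant {μ : Measure ℂ} {F : ℂ → ℂ} {S : Set ℂ}
    (hS : MeasurableSet S) {N : ℝ} (hN : 0 < N) (hSre : ∀ z ∈ S, z.re ∈ Ioo 0 (2 * N))
    {D : ℤ → ℝ≥0∞} (hD : ∀ (k : ℤ), ∀ z ∈ S, |z.im - 2 * N * k| ≤ N → ‖F z‖ₑ ^ 2 ≤ D k)
    {M : ℝ≥0∞} (hM : ∀ a : ℝ, μ (S ∩ carlesonSquare a (a + 2 * N)) ≤ M) :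
    ∫⁻ z in S, ‖F z‖ₑ ^ 2 ∂μ ≤ M * ∑' k, D k := by
  let B : ℤ → Set ℂ := fun k =>
    S ∩ carlesonSquare (2 * N * k - N) (2 * N * k - N + 2 * N)
  have hcover : S ⊆ ⋃ k, B k := by
    intro z hz
    obtain ⟨k, hk⟩ := exists_int_abs_sub_le hN z.im
    rw [abs_le] at hk
    refine mem_iUnion.2 ⟨k, hz, ⟨by linarith, by linarith⟩, ?_⟩
    convert hSre z hz using 2
    ring
  calc ∫⁻ z in S, ‖F z‖ₑ ^ 2 ∂μ ≤ ∫⁻ z in ⋃ k, B k, ‖F z‖ₑ ^ 2 ∂μ := lintegral_mono_set hcover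
    _ ≤ ∑' k, ∫⁻ z in B k, ‖F z‖ₑ ^ 2 ∂μ := lintegral_iUnion_le _ _
    _ ≤ ∑' k, M * D k := by
        refine ENNReal.tsum_le_tsum fun k => ?_
        calc _ ≤ ∫⁻ _ in B k, D k ∂μ := by
              refine setLIntegral_mono' (hS.inter (measurableSet_carlesonSquare _ _)) fun z hz => ?_
              refine hD k z hz.1 (abs_le.2 ⟨?_, ?_⟩)
              · linarith [hz.2.1.1]
              · linarith [hz.2.1.2]
          _ = D k * μ (B k) := setLIntegral_const _ _
          _ ≤ M * D k := by rw [mul_comm]; gcongr; exact hM _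
    _ = _ := ENNReal.tsum_mul_left

theorem lintegral_laplaceOn_le {α : ℝ} (hα : 1 < α) {f : ℝ → ℂ} (hfm : Measurable f)
    (hf : ∫⁻ t in Ioo (0 : ℝ) 1, ENNReal.ofReal (PhiAlpha α ‖f t‖) ≤ 1) {μ : Measure ℂ}
    (hμ : μ {z : ℂ | z.re ≤ 0} = 0) :
    ∫⁻ z, ‖laplaceOn 1 f z‖ₑ ^ 2 ∂μ ≤ ENNReal.ofReal (4 * majorantConst) * carlesonSum α μ := by
  have hc := majorantConst_pos
  set L : Set ℂ := {z | z.re ∈ Ioo 0 2} with hL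
  have hLmeas : MeasurableSet L := Complex.measurable_re measurableSet_Ioo
  have hlow : ∫⁻ z in L, ‖laplaceOn 1 f z‖ₑ ^ 2 ∂μ ≤
      ENNReal.ofReal (4 * majorantConst) * ⨆ a : ℝ, μ (carlesonSquare a (a + 2)) := by
    obtain ⟨D, hD, hDsum⟩ := exists_laplaceOn_majorant_of_PhiAlpha hα hfm hf (n := 1) (N := 1)
      le_rfl le_rfl (by norm_num)
    refine (setLIntegral_le_mul_tsum_of_majorant (μ := μ) hLmeas one_pos (by simp [hL]) (D := D) ?_
      (M := ⨆ a : ℝ, μ (carlesonSquare a (a + 2))) ?_).trans ?_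
    · intro k z hz hk
      refine hD k z hz.1 (by simpa using hz.2.le) ?_ (by simpa using hk)
      intro j hj
      simp [Nat.lt_one_iff.1 hj]
    · intro a
      rw [mul_one]
      exact (measure_mono inter_subset_right).trans
        (le_iSup (fun a : ℝ => μ (carlesonSquare a (a + 2))) a)
    · rw [mul_comm]
      gcongr
      refine hDsum.trans (ENNReal.ofReal_le_ofReal ?_)
      simp
      linarith
  have hstrip : ∀ n : ℕ, ∫⁻ z in dyadicStrip ((n : ℤ) + 1), ‖laplaceOn 1 f z‖ₑ ^ 2 ∂μ ≤
      ENNReal.ofReal (4 * majorantConst) * (((n : ℝ≥0∞) + 1) ^ (2 / α) *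
        carlesonIntensity 2 (stripPart μ ((n : ℤ) + 1))) := by
    intro n
    obtain ⟨D, hD, hDsum⟩ := exists_laplaceOn_majorant_of_PhiAlpha hα hfm hf (n := n + 1)
      (N := 2 ^ (n + 1)) (by omega) Nat.one_le_two_pow le_rfl
    set N : ℕ := 2 ^ (n + 1) with hN
    have hN0 : (0 : ℝ) < N := by rw [hN]; positivity
    have hre : ∀ z ∈ dyadicStrip ((n : ℤ) + 1), (N : ℝ) ≤ z.re ∧ z.re < 2 * N := by
      intro z hz
      have h1 : ((2 : ℝ) ^ ((n : ℤ) + 1)) = N := by rw [hN]; norm_cast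
      have h2 : ((2 : ℝ) ^ ((n : ℤ) + 1 + 1)) = 2 * N := by
        rw [zpow_add₀ two_ne_zero, h1]; ring
      rw [← h2, ← h1]
      exact hz
    refine (setLIntegral_le_mul_tsum_of_majorant (μ := μ) (measurableSet_dyadicStrip _) hN0
      (fun z hz => ⟨hN0.trans_le (hre z hz).1, (hre z hz).2⟩) (D := D) ?_
      (M := carlesonIntensity 2 (stripPart μ ((n : ℤ) + 1)) *
        ENNReal.ofReal ((2 * N) ^ 2)) ?_).trans ?_
    · intro k z hz hk
      refine hD k z (hN0.trans_le (hre z hz).1) (hre z hz).2.le ?_ hk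
      intro j _
      calc (j : ℝ) = N * (j / N) := by field_simp
        _ ≤ _ := by gcongr; exact (hre z hz).1
    · intro a
      have h := stripPart_le_carlesonIntensity μ ((n : ℤ) + 1) (a := a) (b := a + 2 * N)
        (by linarith)
      rw [add_sub_cancel_left] at h
      rwa [stripPart, Measure.restrict_apply (measurableSet_carlesonSquare _ _), inter_comm] at h
    · refine (mul_le_mul_right hDsum _).trans (le_of_eq ?_)
      have e : (((n : ℝ≥0∞) + 1) ^ (2 / α)) = ENNReal.ofReal (((n + 1 : ℕ) : ℝ) ^ (2 / α)) := by
        rw [← ENNReal.ofReal_rpow_of_pos (by positivity), ENNReal.ofReal_natCast]; push_cast; rfl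
      rw [e, mul_assoc, ← ENNReal.ofReal_mul (by positivity), mul_comm, ← mul_assoc,
        ← ENNReal.ofReal_mul (by positivity)]
      congr 2
      field_simp
      norm_num
  have hcover : (univ : Set ℂ) ⊆
      {z : ℂ | z.re ≤ 0} ∪ (L ∪ ⋃ n : ℕ, dyadicStrip ((n : ℤ) + 1)) := by
    intro z _
    rcases le_or_gt z.re 0 with h0 | h0
    · exact Or.inl h0
    rcases lt_or_ge z.re 2 with h2 | h2
    · exact Or.inr (Or.inl ⟨h0, h2⟩)
    refine Or.inr (Or.inr (mem_iUnion.2 ?_))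
    obtain ⟨n, hn⟩ := exists_mem_Ico_zpow h0 one_lt_two
    have hn1 : 1 ≤ n := by
      by_contra! h
      have : (2 : ℝ) ^ (n + 1) ≤ 2 ^ (1 : ℤ) := zpow_le_zpow_right₀ one_le_two (by omega)
      rw [zpow_one] at this
      linarith [hn.2]
    refine ⟨(n - 1).toNat, ?_⟩
    rw [show (((n - 1).toNat : ℤ) + 1) = n by omega]
    exact hn
  calc ∫⁻ z, ‖laplaceOn 1 f z‖ₑ ^ 2 ∂μ
      ≤ ∫⁻ z in {z : ℂ | z.re ≤ 0} ∪ (L ∪ ⋃ n : ℕ, dyadicStrip ((n : ℤ) + 1)),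
          ‖laplaceOn 1 f z‖ₑ ^ 2 ∂μ := by
        rw [← setLIntegral_univ]; exact lintegral_mono_set hcover
    _ ≤ 0 + (ENNReal.ofReal (4 * majorantConst) * (⨆ a : ℝ, μ (carlesonSquare a (a + 2))) +
          ∑' n : ℕ, ENNReal.ofReal (4 * majorantConst) * (((n : ℝ≥0∞) + 1) ^ (2 / α) *
            carlesonIntensity 2 (stripPart μ ((n : ℤ) + 1)))) := by
        refine (lintegral_union_le _ _ _).trans (add_le_add ?_ ?_)
        · rw [setLIntegral_measure_zero _ _ hμ]
        · refine (lintegral_union_le _ _ _).trans (add_le_add hlow ?_)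
          exact (lintegral_iUnion_le _ _).trans (ENNReal.tsum_le_tsum hstrip)
    _ = _ := by
        rw [zero_add, ENNReal.tsum_mul_left, carlesonSum, mul_add, add_comm]

theorem laplaceOn_const_mul (τ : ℝ) (c : ℂ) (f : ℝ → ℂ) (z : ℂ) :
    laplaceOn τ (fun t => c * f t) z = c * laplaceOn τ f z := by
  simp only [laplaceOn, ← integral_const_mul]
  congr 1
  funext t
  ring

theorem eLpNorm_laplaceOn_sq_le {α : ℝ} (hα : 1 < α) {f : ℝ → ℂ} (hfm : Measurable f) {k : ℝ}
    (hk : 0 < k) (hf : ∫⁻ t in Ioo (0 : ℝ) 1, ENNReal.ofReal (PhiAlpha α (‖f t‖ / k)) ≤ 1)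
    {μ : Measure ℂ} (hμ : μ {z : ℂ | z.re ≤ 0} = 0) :
    eLpNorm (laplaceOn 1 f) 2 μ ^ 2 ≤
      ENNReal.ofReal k ^ 2 * (ENNReal.ofReal (4 * majorantConst) * carlesonSum α μ) := by
  have hkc : (k : ℂ) ≠ 0 := by exact_mod_cast hk.ne'
  have h := lintegral_laplaceOn_le hα (f := fun t => (k : ℂ)⁻¹ * f t) (by fun_prop) (by
    simpa [abs_of_pos hk, div_eq_inv_mul] using hf) hμ
  have e : f = fun t => (k : ℂ) * ((k : ℂ)⁻¹ * f t) := by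
    funext t; rw [mul_inv_cancel_left₀ hkc]
  rw [eLpNorm_two_pow_two, e]
  simp only [laplaceOn_const_mul 1 (k : ℂ), enorm_mul, mul_pow]
  rw [lintegral_const_mul' _ _ (by simp)]
  refine mul_le_mul' (le_of_eq ?_) h
  rw [← ofReal_norm, Complex.norm_real, Real.norm_eq_abs, abs_of_pos hk]

theorem luxNorm_le_one {Φ : ℝ → ℝ} {J : Set ℝ} {f : ℝ → ℂ}
    (hf : ∫⁻ s in J, ENNReal.ofReal (Φ ‖f s‖) ≤ 1) : luxNorm Φ J f ≤ 1 :=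
  iInf_le_of_le 1 (iInf_le_of_le one_pos (iInf_le_of_le (by simpa using hf) (by simp)))

theorem ENNReal.le_of_sq_le_sq {x y : ℝ≥0∞} (h : x ^ 2 ≤ y ^ 2) : x ≤ y :=
  (ENNReal.pow_le_pow_left_iff two_ne_zero).1 h

theorem ENNReal.rpow_half_sq (x : ℝ≥0∞) : (x ^ (1 / 2 : ℝ)) ^ 2 = x := by
  rw [← ENNReal.rpow_natCast, ← ENNReal.rpow_mul]; norm_num

theorem lapOrliczOpNormOn_sq_le {α : ℝ} (hα : 1 < α) {μ : Measure ℂ}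
    (hμ : μ {z : ℂ | z.re ≤ 0} = 0) :
    lapOrliczOpNormOn (PhiAlpha α) μ ^ 2 ≤
      ENNReal.ofReal (16 * majorantConst) * carlesonSum α μ := by
  have hc := majorantConst_pos
  rw [← ENNReal.rpow_half_sq (ENNReal.ofReal (16 * majorantConst) * carlesonSum α μ)]
  refine pow_le_pow_left' (iSup_le fun f => iSup_le fun hfm => iSup_le fun hf => ?_) 2
  refine ENNReal.le_of_sq_le_sq ?_
  rw [ENNReal.rpow_half_sq]
  have h2 : luxNorm (PhiAlpha α) (Ioo 0 1) f < 2 := hf.trans_lt ENNReal.one_lt_two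
  simp only [luxNorm, iInf_lt_iff] at h2
  obtain ⟨k, hk, hkf, hk2⟩ := h2
  refine (eLpNorm_laplaceOn_sq_le hα hfm hk hkf hμ).trans ?_
  calc _ ≤ (2 : ℝ≥0∞) ^ 2 * (ENNReal.ofReal (4 * majorantConst) * carlesonSum α μ) := by gcongr
    _ = _ := by
      rw [← mul_assoc, ← ENNReal.ofReal_ofNat 2, ← ENNReal.ofReal_pow two_pos.le,
        ← ENNReal.ofReal_mul (by positivity)]
      congr 2; ring

theorem exists_bound_of_carlesonSum_ne_top {α : ℝ} (hα : 1 < α) {μ : Measure ℂ}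
    (hμ : μ {z : ℂ | z.re ≤ 0} = 0) (hA : carlesonSum α μ ≠ ⊤) :
    ∃ B : ℝ≥0∞, B ≠ ⊤ ∧ ∀ f : ℝ → ℂ, Measurable f →
      eLpNorm (laplaceOn 1 f) 2 μ ≤ B * luxNorm (PhiAlpha α) (Ioo 0 1) f := by
  set Z := ENNReal.ofReal (4 * majorantConst) * carlesonSum α μ with hZ
  have hZt : Z ≠ ⊤ := ENNReal.mul_ne_top ENNReal.ofReal_ne_top hA
  have hBt : Z ^ (1 / 2 : ℝ) + 1 ≠ ⊤ :=
    ENNReal.add_ne_top.2 ⟨ENNReal.rpow_ne_top_of_nonneg (by norm_num) hZt, ENNReal.one_ne_top⟩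
  have hB0 : Z ^ (1 / 2 : ℝ) + 1 ≠ 0 := by simp
  refine ⟨Z ^ (1 / 2 : ℝ) + 1, hBt, fun f hfm => ?_⟩
  simp only [luxNorm, ENNReal.mul_iInf_of_ne hB0 hBt]
  refine le_iInf fun k => le_iInf fun hk => le_iInf fun hkf => ENNReal.le_of_sq_le_sq ?_
  refine (eLpNorm_laplaceOn_sq_le hα hfm hk hkf hμ).trans ?_
  rw [← hZ, mul_pow, mul_comm]
  gcongr
  calc Z = (Z ^ (1 / 2 : ℝ)) ^ 2 := (ENNReal.rpow_half_sq Z).symm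
    _ ≤ _ := by gcongr; exact le_self_add

theorem exists_signs_sum_lintegral_le {X : Type*} [MeasurableSpace X] (μ : Measure X)
    (G : ℕ → X → ℂ) (hG : ∀ i, Measurable (G i)) (m : ℕ) :
    ∃ ε : ℕ → ℝ, (∀ i, |ε i| = 1) ∧
      ∑ i ∈ Finset.range m, ∫⁻ x, ‖G i x‖ₑ ^ 2 ∂μ ≤
        ∫⁻ x, ‖∑ i ∈ Finset.range m, (ε i : ℂ) * G i x‖ₑ ^ 2 ∂μ := by
  induction m with
  | zero => exact ⟨fun _ => 1, by simp, by simp⟩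
  | succ m ih =>
    obtain ⟨ε, hε, hle⟩ := ih
    set S : X → ℂ := fun x => ∑ i ∈ Finset.range m, (ε i : ℂ) * G i x with hS
    have hSm : Measurable S := by
      refine Finset.measurable_fun_sum _ fun i _ => (hG i).const_mul _
    have hpar : (∫⁻ x, ‖S x + G m x‖ₑ ^ 2 ∂μ) + ∫⁻ x, ‖S x - G m x‖ₑ ^ 2 ∂μ =
        2 * ((∫⁻ x, ‖S x‖ₑ ^ 2 ∂μ) + ∫⁻ x, ‖G m x‖ₑ ^ 2 ∂μ) := by
      have hGm := hG m
      rw [← lintegral_add_left (by fun_prop), ← lintegral_add_left (by fun_prop),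
        ← lintegral_const_mul' _ _ ENNReal.ofNat_ne_top]
      refine lintegral_congr fun x => ?_
      have h := parallelogram_law_with_norm ℝ (S x) (G m x)
      have h' := congrArg ENNReal.ofReal h
      rw [ENNReal.ofReal_add (by positivity) (by positivity), ENNReal.ofReal_mul two_pos.le,
        ENNReal.ofReal_add (by positivity) (by positivity)] at h'
      simpa only [ENNReal.ofReal_pow (norm_nonneg _), ofReal_norm, ENNReal.ofReal_ofNat] using h'
    have hupd : ∀ s : ℝ, ∀ x, ∑ i ∈ Finset.range (m + 1),
        ((Function.update ε m s i : ℝ) : ℂ) * G i x = S x + s * G m x := by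
      intro s x
      rw [Finset.sum_range_succ, Function.update_self, hS]
      congr 1
      refine Finset.sum_congr rfl fun i hi => ?_
      rw [Function.update_of_ne (Finset.mem_range.1 hi).ne]
    have habs : ∀ s : ℝ, |s| = 1 → ∀ i, |Function.update ε m s i| = 1 := by
      intro s hs i
      rcases eq_or_ne i m with rfl | h
      · simpa using hs
      · simpa [Function.update_of_ne h] using hε i
    have hsum : ∑ i ∈ Finset.range (m + 1), ∫⁻ x, ‖G i x‖ₑ ^ 2 ∂μ ≤
        (∫⁻ x, ‖S x‖ₑ ^ 2 ∂μ) + ∫⁻ x, ‖G m x‖ₑ ^ 2 ∂μ := by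
      rw [Finset.sum_range_succ]; gcongr
    by_cases hcase : (∫⁻ x, ‖S x‖ₑ ^ 2 ∂μ) + ∫⁻ x, ‖G m x‖ₑ ^ 2 ∂μ ≤
        ∫⁻ x, ‖S x + G m x‖ₑ ^ 2 ∂μ
    · refine ⟨Function.update ε m 1, habs 1 (by simp), hsum.trans (hcase.trans (le_of_eq ?_))⟩
      simp only [hupd, Complex.ofReal_one, one_mul]
    · refine ⟨Function.update ε m (-1), habs (-1) (by simp), hsum.trans ?_⟩
      simp only [hupd, Complex.ofReal_neg, Complex.ofReal_one, neg_mul, one_mul, ← sub_eq_add_neg]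
      by_contra! h
      rw [not_le] at hcase
      have := ENNReal.add_lt_add hcase h
      rw [hpar, two_mul] at this
      exact lt_irrefl _ this

theorem add_sum_iSup_le {ι : Type*} [Nonempty ι] (F : ℕ → ι → ℝ≥0∞) (B : ℝ≥0∞) (m : ℕ) :
    ∀ c : ℝ≥0∞, (∀ y : ℕ → ι, c + ∑ i ∈ Finset.range m, F i (y i) ≤ B) →
      c + ∑ i ∈ Finset.range m, ⨆ x, F i x ≤ B := by
  induction m with
  | zero => intro c h; simpa using h fun _ => Classical.arbitrary ι
  | succ m ih =>
    intro c h
    rw [Finset.sum_range_succ, add_comm (∑ i ∈ _, _), ← add_assoc]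
    refine ih _ fun y => ?_
    rw [add_right_comm, ENNReal.add_iSup]
    refine iSup_le fun x => ?_
    have := h (Function.update y m x)
    rw [Finset.sum_range_succ, Function.update_self, ← add_assoc] at this
    refine le_trans (le_of_eq ?_) this
    congr 2
    refine Finset.sum_congr rfl fun i hi => ?_
    rw [Function.update_of_ne (Finset.mem_range.1 hi).ne]

/-- The modulated indicator function `c e^{iat} 1_J(t)`. -/
def modulated (J : Set ℝ) (c a : ℝ) : ℝ → ℂ :=
  J.indicator fun t => (c : ℂ) * Complex.exp (Complex.I * a * t)

theorem measurable_modulated {J : Set ℝ} (hJ : MeasurableSet J) (c a : ℝ) :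
    Measurable (modulated J c a) :=
  Measurable.indicator (by fun_prop) hJ

theorem norm_modulated_of_mem {J : Set ℝ} {c : ℝ} (hc : 0 ≤ c) (a : ℝ) {t : ℝ} (ht : t ∈ J) :
    ‖modulated J c a t‖ = c := by
  rw [modulated, indicator_of_mem ht, norm_mul, Complex.norm_real, Real.norm_eq_abs,
    abs_of_nonneg hc, Complex.norm_exp]
  simp

theorem integrableOn_modulated {J : Set ℝ} (hJ : MeasurableSet J) (c a : ℝ) :
    IntegrableOn (modulated J c a) (Ioo 0 1) := by
  have h : IntegrableOn (fun t : ℝ => (c : ℂ) * Complex.exp (Complex.I * a * t)) (Ioo 0 1) :=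
    (Continuous.integrableOn_Icc (by fun_prop)).mono_set Ioo_subset_Icc_self
  exact h.indicator hJ

theorem IntegrableOn.exp_mul {f : ℝ → ℂ} (hf : IntegrableOn f (Ioo 0 1)) (z : ℂ) :
    IntegrableOn (fun t : ℝ => Complex.exp (-z * t) * f t) (Ioo 0 1) := by
  have h : IntegrableOn f (Icc 0 1) := by rwa [integrableOn_Icc_iff_integrableOn_Ioo]
  exact (h.continuousOn_mul (g := fun t : ℝ => Complex.exp (-z * t))
    (Continuous.continuousOn (by fun_prop)) isCompact_Icc).mono_set Ioo_subset_Icc_self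

theorem continuous_laplaceOn {f : ℝ → ℂ} (hf : IntegrableOn f (Ioo 0 1)) :
    Continuous (laplaceOn 1 f) := by
  rw [continuous_iff_continuousAt]
  intro z₀
  refine continuousAt_of_dominated (bound := fun t => Real.exp (‖z₀‖ + 1) * ‖f t‖)
    (Eventually.of_forall fun z => (IntegrableOn.exp_mul hf z).1) ?_ (hf.norm.const_mul _) ?_
  · filter_upwards [Metric.ball_mem_nhds z₀ one_pos] with z hz
    refine (ae_restrict_iff' measurableSet_Ioo).2 (Eventually.of_forall fun t ht => ?_)
    rw [norm_mul]
    gcongr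
    rw [Complex.norm_exp]
    refine Real.exp_le_exp.2 ((Complex.re_le_norm _).trans ?_)
    rw [norm_mul, norm_neg, Complex.norm_real, Real.norm_eq_abs, abs_of_pos ht.1]
    have h1 : ‖z‖ ≤ ‖z₀‖ + 1 := by
      have := norm_le_norm_add_norm_sub' z z₀
      rw [Metric.mem_ball, dist_eq_norm] at hz
      linarith
    calc ‖z‖ * t ≤ ‖z‖ * 1 := by gcongr; exact ht.2.le
      _ ≤ _ := by linarith
  · exact Eventually.of_forall fun t => by fun_prop

theorem le_norm_laplaceOn_modulated {J : Set ℝ} (hJ : MeasurableSet J) (hJs : J ⊆ Ioo 0 1)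
    {c : ℝ} (hc : 0 ≤ c) {a : ℝ} {z : ℂ}
    (hz : ∀ t ∈ J, z.re * t ≤ 2 ∧ |(z.im - a) * t| ≤ 1) :
    c * (Real.exp (-2) / 2) * volume.real J ≤ ‖laplaceOn 1 (modulated J c a) z‖ := by
  have hcont : Continuous fun t : ℝ => (c : ℂ) * Complex.exp (-(z - Complex.I * a) * t) := by
    fun_prop
  have hfin : volume J ≠ ⊤ := ((measure_mono hJs).trans_lt (by simp)).ne
  have hint : IntegrableOn (fun t : ℝ => (c : ℂ) * Complex.exp (-(z - Complex.I * a) * t)) J :=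
    (hcont.integrableOn_Icc (a := 0) (b := 1)).mono_set (hJs.trans Ioo_subset_Icc_self)
  have e : laplaceOn 1 (modulated J c a) z =
      ∫ t in J, (c : ℂ) * Complex.exp (-(z - Complex.I * a) * t) := by
    rw [laplaceOn, ← integral_indicator measurableSet_Ioo, ← integral_indicator hJ]
    congr 1
    funext t
    by_cases ht : t ∈ J
    · rw [indicator_of_mem (hJs ht), indicator_of_mem ht, modulated, indicator_of_mem ht,
        mul_left_comm, ← Complex.exp_add]
      ring_nf
    · simp [modulated, indicator_of_notMem ht]
  rw [e]
  refine le_trans ?_ (Complex.re_le_norm _)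
  have hre : (∫ t in J, (c : ℂ) * Complex.exp (-(z - Complex.I * a) * t)).re =
      ∫ t in J, ((c : ℂ) * Complex.exp (-(z - Complex.I * a) * t)).re :=
    (integral_re hint).symm
  rw [hre]
  calc c * (Real.exp (-2) / 2) * volume.real J = ∫ _ in J, c * (Real.exp (-2) / 2) := by
        rw [setIntegral_const, smul_eq_mul, mul_comm]
    _ ≤ _ := by
        refine setIntegral_mono_on (integrableOn_const hfin) hint.re hJ fun t ht => ?_
        obtain ⟨h1, h2⟩ := hz t ht
        have e1 : (-(z - Complex.I * a) * (t : ℂ)).re = -(z.re * t) := by simp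
        have e2 : (-(z - Complex.I * a) * (t : ℂ)).im = -((z.im - a) * t) := by
          simp; ring
        rw [Complex.re_ofReal_mul, Complex.exp_re, e1, e2, Real.cos_neg, div_eq_mul_inv]
        gcongr
        have := Real.one_sub_sq_div_two_le_cos (x := (z.im - a) * t)
        have h3 := (sq_le_one_iff_abs_le_one _).2 h2
        norm_num
        linarith

theorem ofReal_sq_mul_measure_le {μ : Measure ℂ} {F : ℂ → ℂ} {S : Set ℂ} {κ : ℝ} (hκ : 0 ≤ κ)
    (hS : MeasurableSet S) (h : ∀ z ∈ S, κ ≤ ‖F z‖) :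
    ENNReal.ofReal (κ ^ 2) * μ S ≤ ∫⁻ z, ‖F z‖ₑ ^ 2 ∂μ := by
  rw [← setLIntegral_const]
  refine (setLIntegral_mono' hS fun z hz => ?_).trans (setLIntegral_le_lintegral S _)
  rw [← ofReal_norm, ← ENNReal.ofReal_pow (norm_nonneg _)]
  refine ENNReal.ofReal_le_ofReal ?_
  gcongr
  exact h z hz

theorem lintegral_laplaceOn_le_lapOrliczOpNormOn {Φ : ℝ → ℝ} (μ : Measure ℂ) {f : ℝ → ℂ}
    (hfm : Measurable f) (hf : ∫⁻ s in Ioo 0 1, ENNReal.ofReal (Φ ‖f s‖) ≤ 1) :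
    ∫⁻ z, ‖laplaceOn 1 f z‖ₑ ^ 2 ∂μ ≤ lapOrliczOpNormOn Φ μ ^ 2 := by
  rw [← eLpNorm_two_pow_two]
  refine pow_le_pow_left' ?_ 2
  exact le_iSup_of_le f (le_iSup_of_le hfm (le_iSup_of_le (luxNorm_le_one hf) le_rfl))

/-- The constant in the lower bound. -/
def minorantConst : ℝ := Real.exp (-2) ^ 2 / 256

theorem minorantConst_pos : 0 < minorantConst := by unfold minorantConst; positivity

theorem iSup_carlesonSquare_le (α : ℝ) (μ : Measure ℂ) :
    ENNReal.ofReal minorantConst * ⨆ a : ℝ, μ (carlesonSquare a (a + 2)) ≤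
      lapOrliczOpNormOn (PhiAlpha α) μ ^ 2 := by
  rw [ENNReal.mul_iSup]
  refine iSup_le fun a => ?_
  refine le_trans ?_ (lintegral_laplaceOn_le_lapOrliczOpNormOn μ
    (f := modulated (Ioo 0 1) 1 (a + 1)) (measurable_modulated measurableSet_Ioo _ _) ?_)
  · refine le_trans ?_ (ofReal_sq_mul_measure_le (κ := Real.exp (-2) / 2) (by positivity)
      (measurableSet_carlesonSquare a (a + 2)) fun z hz => ?_)
    · gcongr
      unfold minorantConst
      have := sq_nonneg (Real.exp (-2))
      linarith
    · obtain ⟨⟨h1, h2⟩, h3, h4⟩ := hz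
      refine le_trans (by simp) (le_norm_laplaceOn_modulated measurableSet_Ioo subset_rfl
        zero_le_one fun t ht => ⟨?_, ?_⟩)
      · nlinarith [ht.1, ht.2]
      · rw [abs_mul, abs_of_pos ht.1]
        have : |z.im - (a + 1)| ≤ 1 := abs_le.2 ⟨by linarith, by linarith⟩
        exact mul_le_one₀ this ht.1.le ht.2.le
  · calc _ ≤ ∫⁻ _ in Ioo (0 : ℝ) 1, 1 := by
          refine setLIntegral_mono' measurableSet_Ioo fun t ht => ?_
          rw [norm_modulated_of_mem zero_le_one _ ht, ← ENNReal.ofReal_one]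
          refine ENNReal.ofReal_le_ofReal ?_
          unfold PhiAlpha
          rw [Real.one_rpow]
          linarith [Real.exp_one_lt_d9]
      _ = 1 := by simp

/-- The dyadic interval `[2^{-n-1}, 2^{-n})`. -/
def dyadicBlock (n : ℕ) : Set ℝ := Ico (1 / (2 * 2 ^ n)) (1 / 2 ^ n)

theorem dyadicBlock_subset {n : ℕ} : dyadicBlock n ⊆ Ioo 0 1 := fun t ht =>
  ⟨lt_of_lt_of_le (by positivity) ht.1, lt_of_lt_of_le ht.2
    (by rw [div_le_one (by positivity)]; exact one_le_pow₀ one_le_two)⟩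

theorem volume_real_dyadicBlock (n : ℕ) : volume.real (dyadicBlock n) = 1 / (2 * 2 ^ n) := by
  have : (1 : ℝ) / (2 * 2 ^ n) ≤ 1 / 2 ^ n := by gcongr; linarith [pow_pos (two_pos (α := ℝ)) n]
  rw [dyadicBlock, Real.volume_real_Ico_of_le this]
  field_simp
  norm_num

theorem dyadicBlock_eq_of_mem {n m : ℕ} {t : ℝ} (hn : t ∈ dyadicBlock n)
    (hm : t ∈ dyadicBlock m) : n = m := by
  have key : ∀ n m : ℕ, t ∈ dyadicBlock n → t ∈ dyadicBlock m → ¬ n < m := by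
    intro n m hn hm h
    have h1 : (2 : ℝ) * 2 ^ n ≤ 2 ^ m := by
      rw [← pow_succ']; exact pow_le_pow_right₀ one_le_two h
    have h2 : (1 : ℝ) / 2 ^ m ≤ 1 / (2 * 2 ^ n) := by gcongr
    linarith [hn.1, hm.2]
  exact le_antisymm (not_lt.1 (key m n hm hn)) (not_lt.1 (key n m hn hm))

theorem exp_quarter_pow_le (n : ℕ) : Real.exp (n / 4) ≤ (4 / 3) ^ n := by
  have h : Real.exp (1 / 4) ≤ 4 / 3 := by
    have h1 := Real.add_one_le_exp (-(1 / 4 : ℝ))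
    rw [Real.exp_neg] at h1
    have h2 := Real.exp_pos (1 / 4)
    have h3 : (Real.exp (1 / 4))⁻¹ * Real.exp (1 / 4) = 1 := inv_mul_cancel₀ h2.ne'
    nlinarith
  calc Real.exp (n / 4) = Real.exp (1 / 4) ^ n := by rw [← Real.exp_nat_mul]; ring_nf
    _ ≤ _ := by gcongr

/-- The Orlicz modular of a signed sum of modulated dyadic blocks is at most one. -/
theorem lintegral_PhiAlpha_sum_modulated_le {α : ℝ} (hα : 1 < α) (y ε : ℕ → ℝ)
    (hε : ∀ i, |ε i| = 1) (m : ℕ) :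
    ∫⁻ t in Ioo (0 : ℝ) 1, ENNReal.ofReal (PhiAlpha α ‖∑ i ∈ Finset.range m, (ε i : ℂ) *
      modulated (dyadicBlock (i + 1)) ((((i + 1 : ℕ) : ℝ) / 4) ^ (1 / α)) (y i) t‖) ≤ 1 := by
  have hpt : ∀ t : ℝ, ENNReal.ofReal (PhiAlpha α ‖∑ i ∈ Finset.range m, (ε i : ℂ) *
      modulated (dyadicBlock (i + 1)) ((((i + 1 : ℕ) : ℝ) / 4) ^ (1 / α)) (y i) t‖) ≤
      ∑ i ∈ Finset.range m, (dyadicBlock (i + 1)).indicator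
        (fun _ => ENNReal.ofReal ((4 / 3) ^ (i + 1))) t := by
    intro t
    by_cases h : ∃ i ∈ Finset.range m, t ∈ dyadicBlock (i + 1)
    · obtain ⟨i, hi, ht⟩ := h
      refine le_trans ?_ (Finset.single_le_sum (fun _ _ => zero_le) hi)
      rw [indicator_of_mem ht]
      refine ENNReal.ofReal_le_ofReal ?_
      rw [Finset.sum_eq_single i, norm_mul, norm_modulated_of_mem (by positivity) _ ht,
        Complex.norm_real, Real.norm_eq_abs, hε, one_mul, PhiAlpha,
        ← Real.rpow_mul (by positivity), one_div_mul_cancel (by linarith), Real.rpow_one]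
      · have := exp_quarter_pow_le (i + 1)
        have h0 : (0 : ℝ) ≤ ((i + 1 : ℕ) : ℝ) / 4 := by positivity
        linarith
      · intro j _ hj
        rw [modulated, indicator_of_notMem, mul_zero]
        intro hj'
        exact hj (by have := dyadicBlock_eq_of_mem hj' ht; omega)
      · exact fun h' => absurd hi h'
    · push Not at h
      rw [Finset.sum_eq_zero]
      · simp [PhiAlpha, Real.zero_rpow (by linarith : α ≠ 0)]
      · intro i hi
        rw [modulated, indicator_of_notMem (h i hi), mul_zero]
  have hmeas : ∀ n, MeasurableSet (dyadicBlock n) := fun n => measurableSet_Ico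
  refine (lintegral_mono hpt).trans ((setLIntegral_le_lintegral _ _).trans ?_)
  rw [lintegral_finsetSum _ fun i _ => measurable_const.indicator (hmeas _)]
  have hterm : ∀ i : ℕ, ∫⁻ t, (dyadicBlock (i + 1)).indicator
      (fun _ => ENNReal.ofReal ((4 / 3) ^ (i + 1))) t =
      ENNReal.ofReal (1 / 3 * (2 / 3) ^ i) := by
    intro i
    have hfin : volume (dyadicBlock (i + 1)) ≠ ⊤ := by simp [dyadicBlock]
    rw [lintegral_indicator_const (hmeas _), ← ENNReal.ofReal_toReal hfin]
    change _ * ENNReal.ofReal (volume.real _) = _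
    rw [volume_real_dyadicBlock, ← ENNReal.ofReal_mul (by positivity)]
    congr 1
    rw [show (2 / 3 : ℝ) = (4 / 3) / 2 by norm_num, div_pow (4 / 3 : ℝ) 2, pow_succ, pow_succ]
    generalize (4 / 3 : ℝ) ^ i = x
    field_simp
    norm_num
  simp_rw [hterm]
  rw [← ENNReal.ofReal_sum_of_nonneg fun i _ => by positivity, ← ENNReal.ofReal_one]
  refine ENNReal.ofReal_le_ofReal ?_
  rw [← Finset.mul_sum, geom_sum_eq (by norm_num)]
  have : (0 : ℝ) ≤ (2 / 3) ^ m := by positivity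
  norm_num
  linarith

theorem mem_dyadicStrip_natCast {n : ℕ} {z : ℂ} :
    z ∈ dyadicStrip (n : ℤ) ↔ (2 : ℝ) ^ n ≤ z.re ∧ z.re < 2 * 2 ^ n := by
  have h : ((2 : ℝ) ^ ((n : ℤ) + 1)) = 2 * 2 ^ n := by
    rw [zpow_add₀ two_ne_zero, zpow_natCast]; ring
  rw [dyadicStrip, mem_ofPred_eq, h, zpow_natCast]

theorem carlesonIntensity_stripPart_le (μ : Measure ℂ) (n : ℕ) :
    carlesonIntensity 2 (stripPart μ n) ≤ ENNReal.ofReal (2 / (2 ^ n) ^ 2) *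
      ⨆ a : ℝ, stripPart μ n (carlesonSquare a (a + 2 * 2 ^ n)) := by
  set M := ⨆ a : ℝ, stripPart μ n (carlesonSquare a (a + 2 * 2 ^ n)) with hM
  refine iSup_le fun a => iSup_le fun b => iSup_le fun hab => ?_
  have hL : 0 < b - a := sub_pos.2 hab
  have hN : (0 : ℝ) < 2 ^ n := by positivity
  rw [Real.rpow_two]
  refine (ENNReal.div_le_iff (ENNReal.ofReal_pos.2 (by positivity)).ne' ENNReal.ofReal_ne_top).2 ?_
  rcases le_or_gt (b - a) (2 ^ n) with h | h
  · have : stripPart μ n (carlesonSquare a b) = 0 := by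
      rw [stripPart, Measure.restrict_apply (measurableSet_carlesonSquare _ _)]
      convert measure_empty (μ := μ)
      refine eq_empty_iff_forall_notMem.2 fun z hz => ?_
      have h1 := (mem_dyadicStrip_natCast.1 hz.2).1
      linarith [hz.1.2.2]
    rw [this]
    exact zero_le
  · set K := ⌈(b - a) / (2 * 2 ^ n)⌉₊ with hK
    have hcover : carlesonSquare a b ∩ dyadicStrip n ⊆ ⋃ i ∈ Finset.range K,
        carlesonSquare (a + 2 * 2 ^ n * i) (a + 2 * 2 ^ n * i + 2 * 2 ^ n) ∩ dyadicStrip n := by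
      rintro z ⟨⟨⟨h1, h2⟩, h3, h4⟩, hz⟩
      have hz' := mem_dyadicStrip_natCast.1 hz
      have hre : z.re ∈ Ioo 0 (2 * 2 ^ n) := ⟨h3, hz'.2⟩
      have hKpos : 0 < K := Nat.ceil_pos.2 (by positivity)
      have hKle : b - a ≤ K * (2 * 2 ^ n) := (div_le_iff₀ (by positivity)).1 (Nat.le_ceil _)
      set x := (z.im - a) / (2 * 2 ^ n) with hx
      have hx0 : 0 ≤ x := div_nonneg (by linarith) (by positivity)
      have hxe : z.im = a + 2 * 2 ^ n * x := by rw [hx]; field_simp; ring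
      have hxK : x ≤ K := by rw [hx, div_le_iff₀ (by positivity)]; linarith
      simp only [mem_iUnion, Finset.mem_range]
      by_cases hlt : ⌊x⌋₊ < K
      · refine ⟨⌊x⌋₊, hlt, ⟨⟨?_, ?_⟩, by simpa using hre⟩, hz⟩
        · rw [hxe]; gcongr; exact Nat.floor_le hx0
        · have := (Nat.lt_floor_add_one x).le
          rw [hxe]
          nlinarith
      · have hxK' : x = K := le_antisymm hxK ((Nat.le_floor_iff hx0).1 (not_lt.1 hlt))
        have hcast : ((K - 1 : ℕ) : ℝ) = K - 1 := by rw [Nat.cast_sub hKpos]; simp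
        refine ⟨K - 1, by omega, ⟨⟨?_, ?_⟩, by simpa using hre⟩, hz⟩
        · rw [hxe, hxK', hcast]; gcongr; linarith
        · rw [hxe, hxK', hcast]; linarith
    have hle : stripPart μ n (carlesonSquare a b) ≤ K * M := by
      rw [stripPart, Measure.restrict_apply (measurableSet_carlesonSquare _ _)]
      refine (measure_mono hcover).trans ((measure_biUnion_finset_le _ _).trans ?_)
      calc _ ≤ ∑ _i ∈ Finset.range K, M := by
            refine Finset.sum_le_sum fun i _ => ?_
            rw [← Measure.restrict_apply (measurableSet_carlesonSquare _ _)]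
            exact le_iSup (fun a : ℝ => stripPart μ n (carlesonSquare a (a + 2 * 2 ^ n)))
              (a + 2 * 2 ^ n * i)
        _ = K * M := by simp
    refine hle.trans ?_
    rw [mul_right_comm, ← ENNReal.ofReal_mul (by positivity)]
    gcongr
    rw [← ENNReal.ofReal_natCast]
    refine ENNReal.ofReal_le_ofReal ?_
    have hK1 : (K : ℝ) < (b - a) / (2 * 2 ^ n) + 1 := Nat.ceil_lt_add_one (by positivity)
    have hu : 1 < (b - a) / 2 ^ n := by rwa [one_lt_div hN]
    have e1 : (b - a) / (2 * 2 ^ n) = (b - a) / 2 ^ n / 2 := by field_simp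
    have e2 : 2 / (2 ^ n) ^ 2 * (b - a) ^ 2 = 2 * ((b - a) / 2 ^ n) ^ 2 := by field_simp
    rw [e2]
    rw [e1] at hK1
    nlinarith

theorem le_lintegral_laplaceOn_dyadicBlock {α : ℝ} (hα : 1 < α) (μ : Measure ℂ) (n : ℕ) (y : ℝ) :
    ENNReal.ofReal (minorantConst * (n : ℝ) ^ (2 / α) / (2 ^ n) ^ 2) *
        stripPart μ n (carlesonSquare y (y + 2 * 2 ^ n)) ≤
      ∫⁻ z, ‖laplaceOn 1 (modulated (dyadicBlock n) (((n : ℝ) / 4) ^ (1 / α)) (y + 2 ^ n)) z‖ₑ ^ 2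
        ∂μ := by
  have hN : (0 : ℝ) < 2 ^ n := by positivity
  rw [stripPart, Measure.restrict_apply (measurableSet_carlesonSquare _ _)]
  refine le_trans ?_ (ofReal_sq_mul_measure_le
    (κ := ((n : ℝ) / 4) ^ (1 / α) * (Real.exp (-2) / 2) * (1 / (2 * 2 ^ n))) (by positivity)
    ((measurableSet_carlesonSquare y (y + 2 * 2 ^ n)).inter (measurableSet_dyadicStrip (n : ℤ)))
    fun z hz => ?_)
  · gcongr
    have e1 : (((n : ℝ) / 4) ^ (1 / α)) ^ 2 = (n : ℝ) ^ (2 / α) / 4 ^ (2 / α) := by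
      rw [← Real.rpow_natCast, ← Real.rpow_mul (by positivity),
        Real.div_rpow (by positivity) (by norm_num)]
      congr 2 <;> push_cast <;> ring
    have e2 : (4 : ℝ) ^ (2 / α) ≤ 16 := by
      calc (4 : ℝ) ^ (2 / α) ≤ 4 ^ (2 : ℝ) := by
            refine Real.rpow_le_rpow_of_exponent_le (by norm_num) ?_
            rw [div_le_iff₀ (by linarith)]; linarith
        _ = 16 := by norm_num
    rw [mul_pow, mul_pow, e1]
    calc minorantConst * (n : ℝ) ^ (2 / α) / (2 ^ n) ^ 2
        = (n : ℝ) ^ (2 / α) / 16 * (Real.exp (-2) / 2) ^ 2 * (1 / (2 * 2 ^ n)) ^ 2 := by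
          unfold minorantConst; ring
      _ ≤ _ := by gcongr
  · have hre := mem_dyadicStrip_natCast.1 hz.2
    obtain ⟨h1, h2⟩ := hz.1.1
    rw [← volume_real_dyadicBlock]
    refine le_norm_laplaceOn_modulated measurableSet_Ico dyadicBlock_subset (by positivity)
      fun t ht => ?_
    have ht0 : 0 < t := (dyadicBlock_subset ht).1
    have ht1 : 2 ^ n * t ≤ 1 := by
      have := ht.2.le
      rw [le_div_iff₀ hN] at this
      linarith
    constructor
    · nlinarith
    · rw [abs_mul, abs_of_pos ht0]
      have : |z.im - (y + 2 ^ n)| ≤ 2 ^ n := abs_le.2 ⟨by linarith, by linarith⟩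
      nlinarith

theorem tsum_carlesonIntensity_le {α : ℝ} (hα : 1 < α) (μ : Measure ℂ) :
    ENNReal.ofReal (minorantConst / 2) * ∑' n : ℕ, ((n : ℝ≥0∞) + 1) ^ (2 / α) *
      carlesonIntensity 2 (stripPart μ ((n : ℤ) + 1)) ≤
        lapOrliczOpNormOn (PhiAlpha α) μ ^ 2 := by
  have hc := minorantConst_pos
  rw [← ENNReal.tsum_mul_left]
  refine ENNReal.tsum_le_of_sum_range_le fun m => ?_
  have hfin : ∀ y : ℕ → ℝ, 0 + ∑ i ∈ Finset.range m,
      ENNReal.ofReal (minorantConst * ((i + 1 : ℕ) : ℝ) ^ (2 / α) / (2 ^ (i + 1)) ^ 2) *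
        stripPart μ ((i + 1 : ℕ) : ℤ) (carlesonSquare (y i) (y i + 2 * 2 ^ (i + 1))) ≤
      lapOrliczOpNormOn (PhiAlpha α) μ ^ 2 := by
    intro y
    let b : ℕ → ℝ → ℂ := fun i => modulated (dyadicBlock (i + 1))
      ((((i + 1 : ℕ) : ℝ) / 4) ^ (1 / α)) (y i + 2 ^ (i + 1))
    have hb : ∀ i, IntegrableOn (b i) (Ioo 0 1) := fun i =>
      integrableOn_modulated measurableSet_Ico _ _
    have hbm : ∀ i, Measurable (b i) := fun i => measurable_modulated measurableSet_Ico _ _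
    obtain ⟨ε, hε, hle⟩ := exists_signs_sum_lintegral_le μ (fun i => laplaceOn 1 (b i))
      (fun i => (continuous_laplaceOn (hb i)).measurable) m
    have hlin : ∀ z, ∑ i ∈ Finset.range m, (ε i : ℂ) * laplaceOn 1 (b i) z =
        laplaceOn 1 (fun t => ∑ i ∈ Finset.range m, (ε i : ℂ) * b i t) z := by
      intro z
      simp only [← laplaceOn_const_mul]
      simp only [laplaceOn, Finset.mul_sum]
      rw [integral_finsetSum _ fun i _ =>
        IntegrableOn.exp_mul ((hb i).const_mul (ε i : ℂ)) z]
    rw [zero_add]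
    refine (Finset.sum_le_sum fun i _ =>
      le_lintegral_laplaceOn_dyadicBlock hα μ (i + 1) (y i)).trans (hle.trans ?_)
    simp only [hlin]
    exact lintegral_laplaceOn_le_lapOrliczOpNormOn μ
      (Finset.measurable_fun_sum _ fun i _ => (hbm i).const_mul _)
      (lintegral_PhiAlpha_sum_modulated_le hα _ ε hε m)
  have hsup := add_sum_iSup_le (fun (i : ℕ) (y : ℝ) =>
      ENNReal.ofReal (minorantConst * ((i + 1 : ℕ) : ℝ) ^ (2 / α) / (2 ^ (i + 1)) ^ 2) *
        stripPart μ ((i + 1 : ℕ) : ℤ) (carlesonSquare y (y + 2 * 2 ^ (i + 1)))) _ m 0 hfin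
  rw [zero_add] at hsup
  refine le_trans (Finset.sum_le_sum fun i _ => ?_) hsup
  have e : (((i : ℝ≥0∞) + 1) ^ (2 / α)) = ENNReal.ofReal (((i + 1 : ℕ) : ℝ) ^ (2 / α)) := by
    rw [← ENNReal.ofReal_rpow_of_pos (by positivity), ENNReal.ofReal_natCast]; push_cast; rfl
  rw [← ENNReal.mul_iSup, e, ← mul_assoc, ← ENNReal.ofReal_mul (by positivity)]
  refine (mul_le_mul_right (carlesonIntensity_stripPart_le μ (i + 1)) _).trans (le_of_eq ?_)
  rw [← mul_assoc, ← ENNReal.ofReal_mul (by positivity)]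
  congr 2
  field_simp

theorem carlesonSum_le {α : ℝ} (hα : 1 < α) (μ : Measure ℂ) :
    ENNReal.ofReal (minorantConst / 4) * carlesonSum α μ ≤
      lapOrliczOpNormOn (PhiAlpha α) μ ^ 2 := by
  have hc := minorantConst_pos
  have hhalf : ENNReal.ofReal (minorantConst / 4) =
      2⁻¹ * ENNReal.ofReal (minorantConst / 2) := by
    rw [show minorantConst / 4 = 2⁻¹ * (minorantConst / 2) by ring,
      ENNReal.ofReal_mul (by norm_num), ENNReal.ofReal_inv_of_pos two_pos, ENNReal.ofReal_ofNat]
  rw [hhalf, carlesonSum, mul_assoc, mul_add]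
  set X := lapOrliczOpNormOn (PhiAlpha α) μ ^ 2
  have h2 : ENNReal.ofReal (minorantConst / 2) * ⨆ a : ℝ, μ (carlesonSquare a (a + 2)) ≤ X :=
    le_trans (by gcongr; linarith) (iSup_carlesonSquare_le α μ)
  calc _ ≤ 2⁻¹ * (X + X) := by gcongr; exact tsum_carlesonIntensity_le hα μ
    _ = X := by
      rw [← two_mul, ← mul_assoc, ENNReal.inv_mul_cancel two_ne_zero ENNReal.ofNat_ne_top, one_mul]

theorem lapOrliczOpNormOn_le_of_bound {Φ : ℝ → ℝ} {μ : Measure ℂ} {B : ℝ≥0∞}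
    (hB : ∀ f : ℝ → ℂ, Measurable f → eLpNorm (laplaceOn 1 f) 2 μ ≤ B * luxNorm Φ (Ioo 0 1) f) :
    lapOrliczOpNormOn Φ μ ≤ B :=
  iSup_le fun f => iSup_le fun hfm => iSup_le fun hf =>
    (hB f hfm).trans (mul_le_of_le_one_right' hf)

/-- for `α > 1`, `𝓛 : L^{Φ_α}(0,1) → L²(ℂ₊,μ)` is bounded iff
`∑_{n≥1} n^{2/α} 𝒞₂[μ_n] + sup_{|I|=2} μ(Q_I) < ∞`, with an associated equivalence of
norms. -/
theorem laplace_carleson_PhiAlpha (α : ℝ) (hα : 1 < α) :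
    ∃ c C : ℝ, 0 < c ∧ 0 < C ∧
      ∀ (μ : Measure ℂ), μ {z : ℂ | z.re ≤ 0} = 0 →
        ((∃ B : ℝ≥0∞, B ≠ ⊤ ∧
            ∀ f : ℝ → ℂ, Measurable f →
              eLpNorm (laplaceOn 1 f) 2 μ ≤ B * luxNorm (PhiAlpha α) (Ioo 0 1) f) ↔
          ((∑' n : ℕ, ((n : ℝ≥0∞) + 1) ^ (2 / α) *
              carlesonIntensity 2 (stripPart μ ((n : ℤ) + 1))) +
            ⨆ a : ℝ, μ (carlesonSquare a (a + 2))) ≠ ⊤) ∧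
        ENNReal.ofReal c *
            ((∑' n : ℕ, ((n : ℝ≥0∞) + 1) ^ (2 / α) *
                carlesonIntensity 2 (stripPart μ ((n : ℤ) + 1))) +
              ⨆ a : ℝ, μ (carlesonSquare a (a + 2))) ≤
          lapOrliczOpNormOn (PhiAlpha α) μ ^ 2 ∧
        lapOrliczOpNormOn (PhiAlpha α) μ ^ 2 ≤
          ENNReal.ofReal C *
            ((∑' n : ℕ, ((n : ℝ≥0∞) + 1) ^ (2 / α) *
                carlesonIntensity 2 (stripPart μ ((n : ℤ) + 1))) +
              ⨆ a : ℝ, μ (carlesonSquare a (a + 2))) := by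
  have hc := minorantConst_pos
  refine ⟨minorantConst / 4, 16 * majorantConst, by positivity,
    mul_pos (by norm_num) majorantConst_pos, fun μ hμ => ⟨⟨?_, ?_⟩, carlesonSum_le hα μ,
      lapOrliczOpNormOn_sq_le hα hμ⟩⟩
  · rintro ⟨B, hBt, hB⟩ htop
    have h := (carlesonSum_le hα μ).trans
      (pow_le_pow_left' (lapOrliczOpNormOn_le_of_bound hB) 2)
    rw [show carlesonSum α μ = ⊤ from htop,
      ENNReal.mul_top (ENNReal.ofReal_pos.2 (by positivity)).ne', top_le_iff] at h
    exact ENNReal.pow_ne_top hBt h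
  · exact exists_bound_of_carlesonSum_ne_top hα hμ
end
end

section
/- Let Φ_exp(t) = e^t − t − 1. There is an absolute constant C > 0 such that for every integer N ≥ 1 and every measurable f : (0,1) → ℂ with ‖f‖_{L^{Φ_exp}(0,1)} ≤ 1 (equivalently, ∫₀^1 (e^{|f(t)|} − |f(t)| − 1) dt ≤ 1), one has ∫₀^1 |f(t)|²·e^{−2^{N+1}·t} dt ≤ C·N²·2^{−N}. -/
open MeasureTheory Set Complex Filter
open scoped ENNReal NNReal

noncomputable section

/-- The quantity `x ^ 2 * 2 ^ N` is controlled by `exp x - x - 1` once `x ≥ 4 * N`. -/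
theorem sq_mul_two_pow_le_exp_sub (N : ℕ) (hN : 1 ≤ N) (x : ℝ) (hx : 4 * (N : ℝ) ≤ x) :
    x ^ 2 * 2 ^ N ≤ 32 * (Real.exp x - x - 1) := by
  have hN' : (1 : ℝ) ≤ N := by exact_mod_cast hN
  have hx4 : 4 ≤ x := by linarith
  have h2N : (2 : ℝ) ^ N ≤ Real.exp (x / 4) := by
    calc (2 : ℝ) ^ N ≤ Real.exp 1 ^ N := by
          gcongr
          linarith [Real.add_one_le_exp (1 : ℝ)]
      _ = Real.exp N := by rw [← Real.exp_nat_mul, mul_one]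
      _ ≤ Real.exp (x / 4) := Real.exp_le_exp.2 (by linarith)
  have hsq : x ^ 2 ≤ 32 * Real.exp (x / 4) := by
    have := Real.quadratic_le_exp_of_nonneg (x := x / 4) (by linarith)
    nlinarith
  have hhalf : Real.exp (x / 4) * Real.exp (x / 4) = Real.exp (x / 2) := by
    rw [← Real.exp_add]; congr 1; ring
  have hfull : Real.exp (x / 2) * Real.exp (x / 2) = Real.exp x := by
    rw [← Real.exp_add]; congr 1; ring
  have hgrow : Real.exp (x / 2) ≤ Real.exp x - x - 1 := by
    have := Real.add_one_le_exp (x / 2)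
    rw [← hfull]
    nlinarith [mul_le_mul this (sub_le_sub_right this 1) (by linarith) (Real.exp_pos _).le]
  calc x ^ 2 * 2 ^ N ≤ (32 * Real.exp (x / 4)) * Real.exp (x / 4) := by gcongr
    _ = 32 * Real.exp (x / 2) := by rw [mul_assoc, hhalf]
    _ ≤ 32 * (Real.exp x - x - 1) := by gcongr

theorem sq_mul_le_add_exp_sub (N : ℕ) (hN : 1 ≤ N) (x w : ℝ) (hx : 0 ≤ x) (hw : 0 ≤ w)
    (hw1 : w ≤ 1) :
    x ^ 2 * w ≤ 16 * (N : ℝ) ^ 2 * w + 32 / 2 ^ N * (Real.exp x - x - 1) := by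
  have hΦ : 0 ≤ Real.exp x - x - 1 := by linarith [Real.add_one_le_exp x]
  rcases le_total x (4 * (N : ℝ)) with h | h
  · have h1 : x ^ 2 * w ≤ (4 * (N : ℝ)) ^ 2 * w := by gcongr
    have h2 : 0 ≤ 32 / 2 ^ N * (Real.exp x - x - 1) := by positivity
    linarith
  · have h1 : x ^ 2 ≤ 32 / 2 ^ N * (Real.exp x - x - 1) := by
      rw [div_mul_eq_mul_div, le_div_iff₀ (by positivity)]
      exact sq_mul_two_pow_le_exp_sub N hN x h
    have h2 : x ^ 2 * w ≤ x ^ 2 := mul_le_of_le_one_right (by positivity) hw1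
    have h3 : 0 ≤ 16 * (N : ℝ) ^ 2 * w := by positivity
    linarith

theorem lintegral_Ioo_exp_neg_mul_le (a : ℝ) (ha : 0 < a) :
    ∫⁻ t in Ioo (0 : ℝ) 1, ENNReal.ofReal (Real.exp (-a * t)) ≤ ENNReal.ofReal (1 / a) := by
  calc ∫⁻ t in Ioo (0 : ℝ) 1, ENNReal.ofReal (Real.exp (-a * t))
      ≤ ∫⁻ t in Ioi (0 : ℝ), ENNReal.ofReal (Real.exp (-a * t)) :=
        lintegral_mono_set Ioo_subset_Ioi_self
    _ = ENNReal.ofReal (∫ t in Ioi (0 : ℝ), Real.exp (-a * t)) :=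
        (ofReal_integral_eq_lintegral_ofReal (integrableOn_exp_mul_Ioi (by linarith) 0)
          (Eventually.of_forall fun t => (Real.exp_pos _).le)).symm
    _ = ENNReal.ofReal (1 / a) := by
        rw [integral_exp_mul_Ioi (by linarith) 0]
        simp

/-- there is an absolute constant `C > 0` such that for every `N ≥ 1` and
every measurable `f : (0,1) → ℂ` with `∫₀¹ (e^{|f|} − |f| − 1) ≤ 1` (i.e.
`‖f‖_{L^{Φ_exp}(0,1)} ≤ 1`), one has `∫₀¹ |f(t)|² e^{−2^{N+1}t} dt ≤ C N² 2^{−N}`. -/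
theorem exp_orlicz_weighted_L2_bound :
    ∃ C : ℝ, 0 < C ∧
      ∀ N : ℕ, 1 ≤ N →
        ∀ f : ℝ → ℂ, Measurable f →
          (∫⁻ t in Ioo (0:ℝ) 1,
              ENNReal.ofReal (Real.exp ‖f t‖ - ‖f t‖ - 1)) ≤ 1 →
          (∫⁻ t in Ioo (0:ℝ) 1,
              (‖f t‖₊ : ℝ≥0∞) ^ 2 *
                ENNReal.ofReal (Real.exp (-(2:ℝ) ^ (N + 1) * t))) ≤
            ENNReal.ofReal (C * (N : ℝ) ^ 2 / 2 ^ N) := by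
  refine ⟨40, by norm_num, fun N hN f _ hf_int => ?_⟩
  have hN' : (1 : ℝ) ≤ N := by exact_mod_cast hN
  set w : ℝ → ℝ := fun t => Real.exp (-(2:ℝ) ^ (N + 1) * t)
  set Φ : ℝ → ℝ := fun t => Real.exp ‖f t‖ - ‖f t‖ - 1 with hΦ
  have hpt : ∀ t ∈ Ioo (0 : ℝ) 1, (‖f t‖₊ : ℝ≥0∞) ^ 2 * ENNReal.ofReal (w t) ≤
      ENNReal.ofReal (16 * (N : ℝ) ^ 2) * ENNReal.ofReal (w t) +
        ENNReal.ofReal (32 / 2 ^ N) * ENNReal.ofReal (Φ t) := by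
    intro t ht
    have hw1 : w t ≤ 1 := Real.exp_le_one_iff.2 (by
      have := mul_pos (pow_pos (two_pos (α := ℝ)) (N + 1)) ht.1
      linarith)
    have hΦ0 : 0 ≤ Φ t := by
      have := Real.add_one_le_exp ‖f t‖
      simp only [hΦ]; linarith
    have hw0 : 0 ≤ w t := (Real.exp_pos _).le
    have hf : (‖f t‖₊ : ℝ≥0∞) = ENNReal.ofReal ‖f t‖ := (ofReal_norm (f t)).symm
    rw [hf, ← ENNReal.ofReal_pow (norm_nonneg _), ← ENNReal.ofReal_mul (by positivity),
      ← ENNReal.ofReal_mul (by positivity), ← ENNReal.ofReal_mul (by positivity),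
      ← ENNReal.ofReal_add (by positivity) (by positivity)]
    exact ENNReal.ofReal_le_ofReal
      (sq_mul_le_add_exp_sub N hN _ _ (norm_nonneg _) hw0 hw1)
  have hwm : Measurable fun t => ENNReal.ofReal (w t) := by fun_prop
  calc ∫⁻ t in Ioo (0 : ℝ) 1, (‖f t‖₊ : ℝ≥0∞) ^ 2 * ENNReal.ofReal (w t)
      ≤ ∫⁻ t in Ioo (0 : ℝ) 1, (ENNReal.ofReal (16 * (N : ℝ) ^ 2) * ENNReal.ofReal (w t) +
        ENNReal.ofReal (32 / 2 ^ N) * ENNReal.ofReal (Φ t)) :=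
        setLIntegral_mono' measurableSet_Ioo hpt
    _ = ENNReal.ofReal (16 * (N : ℝ) ^ 2) * (∫⁻ t in Ioo (0 : ℝ) 1, ENNReal.ofReal (w t)) +
        ENNReal.ofReal (32 / 2 ^ N) * ∫⁻ t in Ioo (0 : ℝ) 1, ENNReal.ofReal (Φ t) := by
        rw [lintegral_add_left (hwm.const_mul _), lintegral_const_mul _ hwm,
          lintegral_const_mul' _ _ ENNReal.ofReal_ne_top]
    _ ≤ ENNReal.ofReal (16 * (N : ℝ) ^ 2) * ENNReal.ofReal (1 / 2 ^ (N + 1)) +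
        ENNReal.ofReal (32 / 2 ^ N) * 1 := by
        gcongr
        exact lintegral_Ioo_exp_neg_mul_le _ (by positivity)
    _ = ENNReal.ofReal (16 * (N : ℝ) ^ 2 * (1 / 2 ^ (N + 1)) + 32 / 2 ^ N) := by
        rw [mul_one, ← ENNReal.ofReal_mul (by positivity),
          ← ENNReal.ofReal_add (by positivity) (by positivity)]
    _ ≤ ENNReal.ofReal (40 * (N : ℝ) ^ 2 / 2 ^ N) := by
        apply ENNReal.ofReal_le_ofReal
        have : 16 * (N : ℝ) ^ 2 * (1 / 2 ^ (N + 1)) + 32 / 2 ^ N =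
            (8 * (N : ℝ) ^ 2 + 32) / 2 ^ N := by
          rw [pow_succ]; field_simp; ring
        rw [this]
        gcongr
        nlinarith
end
end
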